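/- arXiv:1102.3438 — 2 statements merged into one kernel-verified Lean document; each statement's English description precedes it below -/
import Mathlib

section
/- Let X be a random vector in ℝ^d satisfying E[|X|²] = σ²d, E| |X|²σ^{-2} − d | ≤ L√d, and sup_{ξ∈S^{d−1}} E⟨ξ,X⟩² ≤ 1. Fix a > 0 and b < 2, and suppose k = δ log(d)/log(log d) with a ≤ δ ≤ b. Then there exist constants c, c', C, C' > 0 depending only on a and b (and L) such that, setting ε = 2 exp[ −c log(log d)/δ ], there is a subset T ⊆ W_{d,k} with P_{d,k}[T] ≥ 1 − C exp(−c' d ε²) such that for all θ ∈ T, d_BL(X_θ, σZ) ≤ C' ε, where Z is a standard Gaussian vector in ℝ^k. -/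
open MeasureTheory ProbabilityTheory Real
open scoped ENNReal NNReal RealInnerProductSpace

noncomputable section

/-- The Stiefel manifold: `k`-tuples of orthonormal vectors in `ℝ^d`. -/
def Stiefel (d k : ℕ) : Type :=
  {θ : Fin k → EuclideanSpace ℝ (Fin d) // Orthonormal ℝ θ}

instance (d k : ℕ) : MeasurableSpace (Stiefel d k) :=
  Subtype.instMeasurableSpace

/-- The metric `ρ` on the Stiefel manifold. -/
def stiefelDist {d k : ℕ} (θ θ' : Stiefel d k) : ℝ :=
  Real.sqrt (∑ j : Fin k, ‖θ.1 j - θ'.1 j‖ ^ 2)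

/-- The projection `x ↦ (⟨x,θ₁⟩, …, ⟨x,θ_k⟩)` onto the span of `θ`. -/
def stiefelProj {d k : ℕ} (θ : Stiefel d k) (x : EuclideanSpace ℝ (Fin d)) :
    EuclideanSpace ℝ (Fin k) :=
  (EuclideanSpace.equiv (Fin k) ℝ).symm fun i => ⟪θ.1 i, x⟫

/-- Rotation of a Stiefel frame by a linear isometry of `ℝ^d`. -/
def stiefelRotate {d k : ℕ}
    (U : EuclideanSpace ℝ (Fin d) ≃ₗᵢ[ℝ] EuclideanSpace ℝ (Fin d))
    (θ : Stiefel d k) : Stiefel d k :=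
  ⟨fun i => U (θ.1 i), θ.2.comp_linearIsometryEquiv U⟩

/-- A probability measure on the Stiefel manifold is Haar if it is invariant
under every rotation of `ℝ^d`. -/
def IsHaarStiefel {d k : ℕ} (μ : Measure (Stiefel d k)) : Prop :=
  IsProbabilityMeasure μ ∧
    ∀ U : EuclideanSpace ℝ (Fin d) ≃ₗᵢ[ℝ] EuclideanSpace ℝ (Fin d),
      μ.map (stiefelRotate U) = μ

/-- The standard Gaussian measure on `ℝ^k`. -/
def stdGaussian (k : ℕ) : Measure (EuclideanSpace ℝ (Fin k)) :=
  (Measure.pi fun _ : Fin k => gaussianReal 0 1).map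
    (EuclideanSpace.equiv (Fin k) ℝ).symm

/-- The bounded-Lipschitz distance between two measures on `ℝ^k`: the supremum of
`|∫ f dμ - ∫ f dν|` over `f` with `‖f‖_∞ ≤ 1` which are `1`-Lipschitz. -/
def dBL {k : ℕ} (μ ν : Measure (EuclideanSpace ℝ (Fin k))) : ℝ :=
  ⨆ f : {f : EuclideanSpace ℝ (Fin k) → ℝ // (∀ x, |f x| ≤ 1) ∧ LipschitzWith 1 f},
    |∫ x, f.1 x ∂μ - ∫ x, f.1 x ∂ν|

section GaussConc
variable {H : Type*} [NormedAddCommGroup H] [InnerProductSpace ℝ H] [FiniteDimensional ℝ H]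
  [MeasurableSpace H] [BorelSpace H]

lemma gc_mgf (l : H →L[ℝ] ℝ) :
    ∫⁻ x, ENNReal.ofReal (exp (l x)) ∂(ProbabilityTheory.stdGaussian H)
      = ENNReal.ofReal (exp (‖l‖ ^ 2 / 2)) := by
  have h1 : (ProbabilityTheory.stdGaussian H).map l
      = gaussianReal 0 (‖l‖ ^ 2).toNNReal := by
    rw [IsGaussian.map_eq_gaussianReal, variance_dual_stdGaussian, integral_strongDual_stdGaussian]
  have h2 : ∫⁻ x, ENNReal.ofReal (exp (l x)) ∂(ProbabilityTheory.stdGaussian H)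
      = ∫⁻ y, ENNReal.ofReal (exp y) ∂((ProbabilityTheory.stdGaussian H).map l) := by
    rw [lintegral_map (by fun_prop) (by fun_prop)]
  rw [h2, h1, ← ofReal_integral_eq_lintegral_ofReal]
  · have := congrFun (mgf_id_gaussianReal (μ := 0) (v := (‖l‖ ^ 2).toNNReal)) 1
    simp only [mgf, id, one_mul] at this
    rw [this]
    simp
  · simpa using integrable_exp_mul_gaussianReal (μ := 0) (v := (‖l‖ ^ 2).toNNReal) 1
  · exact Filter.Eventually.of_forall fun x => (exp_pos _).le

lemma gc_C1 {F : H → ℝ} {K : ℝ≥0} (hF : ContDiff ℝ 1 F) (hK : LipschitzWith K F) :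
    ∫⁻ p, ENNReal.ofReal (exp (F p.1 - F p.2))
      ∂((ProbabilityTheory.stdGaussian H).prod (ProbabilityTheory.stdGaussian H))
      ≤ ENNReal.ofReal (exp (π ^ 2 * K ^ 2 / 8)) := by
  set γ := ProbabilityTheory.stdGaussian H
  -- the integrand along the path
  let Φ : H × H → ℝ := fun q => exp ((π / 2) * fderiv ℝ F q.1 q.2)
  have hfd : Continuous (fderiv ℝ F) := hF.continuous_fderiv (by simp)
  have hΦc : Continuous Φ := by
    refine Real.continuous_exp.comp (continuous_const.mul ?_)
    exact (hfd.comp continuous_fst).clm_apply continuous_snd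
  have hpath : ∀ p : H × H, Continuous fun t : ℝ =>
      ((ContinuousLinearMap.rotation t (p.2, p.1) : H × H)) := by
    intro p
    simp only [ContinuousLinearMap.rotation_apply]
    fun_prop
  have hpt : ∀ p : H × H, exp (F p.1 - F p.2) ≤
      (π / 2)⁻¹ * ∫ t in (0:ℝ)..(π / 2), Φ (ContinuousLinearMap.rotation t (p.2, p.1)) := by
    intro p
    have hder : ∀ t : ℝ, HasDerivAt (fun t => F ((ContinuousLinearMap.rotation t (p.2, p.1) : H × H).1))
        (fderiv ℝ F (ContinuousLinearMap.rotation t (p.2, p.1) : H × H).1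
          (ContinuousLinearMap.rotation t (p.2, p.1) : H × H).2) t := by
      intro t
      have h1 : HasDerivAt (fun t : ℝ => (ContinuousLinearMap.rotation t (p.2, p.1) : H × H).1)
          ((ContinuousLinearMap.rotation t (p.2, p.1) : H × H).2) t := by
        simp only [ContinuousLinearMap.rotation_apply]
        exact ((Real.hasDerivAt_cos t).smul_const p.2).add ((Real.hasDerivAt_sin t).smul_const p.1)
      exact ((hF.differentiable (by simp)).differentiableAt.hasFDerivAt).comp_hasDerivAt t h1
    have hcont : Continuous fun t : ℝ => fderiv ℝ F (ContinuousLinearMap.rotation t (p.2, p.1) : H × H).1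
          (ContinuousLinearMap.rotation t (p.2, p.1) : H × H).2 :=
      (hfd.comp (continuous_fst.comp (hpath p))).clm_apply (continuous_snd.comp (hpath p))
    have hftc := intervalIntegral.integral_eq_sub_of_hasDerivAt (a := 0) (b := π / 2)
      (fun t _ => hder t) (hcont.intervalIntegrable _ _)
    simp only [ContinuousLinearMap.rotation_apply, cos_pi_div_two, sin_pi_div_two, cos_zero,
      sin_zero, zero_smul, one_smul, zero_add, add_zero] at hftc
    have hpi : (0:ℝ) < π / 2 := by positivity
    have hvol : (volume (Set.Ioc (0:ℝ) (π / 2))) ≠ 0 := by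
      simp [hpi]
    have hJ := ConvexOn.map_set_average_le (μ := volume) (t := Set.Ioc (0:ℝ) (π / 2))
      (s := Set.univ) (g := exp)
      (f := fun t : ℝ => (π / 2) * fderiv ℝ F (ContinuousLinearMap.rotation t (p.2, p.1) : H × H).1
          (ContinuousLinearMap.rotation t (p.2, p.1) : H × H).2)
      convexOn_exp Real.continuous_exp.continuousOn isClosed_univ hvol (by simp) (by simp)
      ((continuous_const.mul hcont).intervalIntegrable 0 (π/2)).1
      ((Real.continuous_exp.comp (continuous_const.mul hcont)).intervalIntegrable 0 (π/2)).1
    rw [setAverage_eq, setAverage_eq] at hJ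
    simp only [Measure.real, Real.volume_Ioc, sub_zero, ENNReal.toReal_ofReal hpi.le, smul_eq_mul] at hJ
    rw [integral_const_mul] at hJ
    rw [← intervalIntegral.integral_of_le hpi.le, ← intervalIntegral.integral_of_le hpi.le] at hJ
    rw [inv_mul_cancel_left₀ hpi.ne'] at hJ
    simp only [ContinuousLinearMap.rotation_apply] at hJ ⊢
    rw [hftc] at hJ
    exact hJ
  have hpi : (0:ℝ) < π / 2 := by positivity
  have hjm : Measurable fun z : (H × H) × ℝ =>
      ENNReal.ofReal (Φ (ContinuousLinearMap.rotation z.2 (z.1.2, z.1.1))) := by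
    refine ENNReal.measurable_ofReal.comp (hΦc.comp ?_).measurable
    simp only [ContinuousLinearMap.rotation_apply]
    fun_prop
  calc ∫⁻ p, ENNReal.ofReal (exp (F p.1 - F p.2)) ∂(γ.prod γ)
      ≤ ∫⁻ p, (ENNReal.ofReal (π / 2)⁻¹ * ∫⁻ t in Set.Ioc (0:ℝ) (π / 2),
          ENNReal.ofReal (Φ (ContinuousLinearMap.rotation t (p.2, p.1)))) ∂(γ.prod γ) := by
        refine lintegral_mono fun p => ?_
        refine (ENNReal.ofReal_le_ofReal (hpt p)).trans ?_
        rw [ENNReal.ofReal_mul (by positivity), intervalIntegral.integral_of_le hpi.le,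
          ofReal_integral_eq_lintegral_ofReal]
        · exact ((hΦc.comp (hpath p)).intervalIntegrable 0 (π/2)).1
        · exact Filter.Eventually.of_forall fun x => (exp_pos _).le
    _ = ENNReal.ofReal (π / 2)⁻¹ * ∫⁻ t in Set.Ioc (0:ℝ) (π / 2), ∫⁻ p,
          ENNReal.ofReal (Φ (ContinuousLinearMap.rotation t (p.2, p.1))) ∂(γ.prod γ) := by
        rw [lintegral_const_mul, lintegral_lintegral_swap hjm.aemeasurable]
        exact hjm.lintegral_prod_right'
    _ ≤ ENNReal.ofReal (π / 2)⁻¹ * ∫⁻ t in Set.Ioc (0:ℝ) (π / 2),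
          ENNReal.ofReal (exp (π ^ 2 * K ^ 2 / 8)) := by
        gcongr with t
        have e1 : ∫⁻ p, ENNReal.ofReal (Φ (ContinuousLinearMap.rotation t (p.2, p.1))) ∂(γ.prod γ)
            = ∫⁻ q, ENNReal.ofReal (Φ q) ∂(γ.prod γ) := by
          have hrot := IsGaussian.map_rotation_eq_self_of_forall_strongDual_eq_zero
            (μ := γ) (fun l => integral_strongDual_stdGaussian l) t
          conv_rhs => rw [← hrot]
          rw [lintegral_map (by fun_prop) (by fun_prop)]
          conv_rhs => rw [← Measure.prod_swap]
          rw [lintegral_map (by fun_prop) (by fun_prop)]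
          rfl
        rw [e1, lintegral_prod _ (by fun_prop)]
        calc ∫⁻ x, ∫⁻ y, ENNReal.ofReal (Φ (x, y)) ∂γ ∂γ
            ≤ ∫⁻ x, ENNReal.ofReal (exp (π ^ 2 * K ^ 2 / 8)) ∂γ := by
              refine lintegral_mono fun x => ?_
              have := gc_mgf ((π / 2) • fderiv ℝ F x)
              simp only [smul_apply, smul_eq_mul] at this
              simp only [Φ, γ]
              rw [this]
              refine ENNReal.ofReal_le_ofReal (exp_le_exp.2 ?_)
              rw [norm_smul, Real.norm_of_nonneg hpi.le]
              have h2 : ‖fderiv ℝ F x‖ ≤ K := norm_fderiv_le_of_lipschitz ℝ hK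
              have h3 : ‖fderiv ℝ F x‖ ^ 2 ≤ (K:ℝ) ^ 2 := by gcongr
              nlinarith [sq_nonneg π, mul_le_mul_of_nonneg_left h3 (sq_nonneg π)]
          _ = _ := by simp
    _ = ENNReal.ofReal (exp (π ^ 2 * K ^ 2 / 8)) := by
        rw [lintegral_const, Measure.restrict_apply_univ, Real.volume_Ioc, sub_zero, mul_comm,
          mul_assoc, ← ENNReal.ofReal_mul hpi.le, mul_inv_cancel₀ hpi.ne']
        simp

lemma gc_smooth {F : H → ℝ} {K : ℝ≥0} (hK : LipschitzWith K F) :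
    ∃ F' : H → ℝ, ContDiff ℝ 1 F' ∧ LipschitzWith K F' ∧ ∀ x, |F' x - F x| ≤ 1 / 2 := by
  have hr : (0:ℝ) < 1 / (2 * (K + 1)) := by positivity
  let φ : ContDiffBump (0 : H) := ⟨1 / (2 * (K + 1)) / 2, 1 / (2 * (K + 1)), by positivity, by linarith⟩
  let F' : H → ℝ := MeasureTheory.convolution (φ.normed volume) F (ContinuousLinearMap.lsmul ℝ ℝ) volume
  have hint : ∀ x, Integrable (fun t => φ.normed volume t * F (x - t)) volume := by
    intro x
    refine Continuous.integrable_of_hasCompactSupport ?_ ?_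
    · exact φ.continuous_normed.mul (hK.continuous.comp (by fun_prop))
    · exact φ.hasCompactSupport_normed.mul_right
  refine ⟨F', ?_, ?_, ?_⟩
  · exact φ.hasCompactSupport_normed.contDiff_convolution_left _ φ.contDiff_normed
      hK.continuous.locallyIntegrable
  · refine LipschitzWith.of_dist_le_mul fun x y => ?_
    rw [Real.dist_eq]
    simp only [F', convolution_def, ContinuousLinearMap.lsmul_apply, smul_eq_mul]
    rw [← integral_sub (hint x) (hint y), ← Real.norm_eq_abs]
    calc _ ≤ ∫ t, φ.normed volume t * (K * dist x y) := by
          refine norm_integral_le_of_norm_le ((φ.integrable_normed).mul_const _) ?_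
          refine Filter.Eventually.of_forall fun t => ?_
          rw [← mul_sub, norm_mul, Real.norm_of_nonneg (φ.nonneg_normed t)]
          gcongr
          · exact φ.nonneg_normed t
          · have := hK.dist_le_mul (x - t) (y - t)
            simpa [Real.dist_eq] using this
      _ = _ := by rw [integral_mul_const, φ.integral_normed, one_mul]
  · intro x
    rw [← Real.dist_eq]
    refine φ.dist_normed_convolution_le hK.continuous.aestronglyMeasurable fun y hy => ?_
    refine (hK.dist_le_mul y x).trans ?_
    have : dist y x < 1 / (2 * (K + 1)) := hy
    calc (K:ℝ) * dist y x ≤ (K + 1) * (1 / (2 * (K + 1))) := by gcongr; linarith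
      _ = 1 / 2 := by field_simp

lemma gc_lip {F : H → ℝ} {K : ℝ≥0} (hK : LipschitzWith K F) :
    ∫⁻ p, ENNReal.ofReal (exp (F p.1 - F p.2))
      ∂((ProbabilityTheory.stdGaussian H).prod (ProbabilityTheory.stdGaussian H))
      ≤ ENNReal.ofReal (exp (1 + π ^ 2 * K ^ 2 / 8)) := by
  obtain ⟨F', h1, h2, h3⟩ := gc_smooth hK
  calc _ ≤ ∫⁻ p, ENNReal.ofReal (exp 1) * ENNReal.ofReal (exp (F' p.1 - F' p.2))
      ∂((ProbabilityTheory.stdGaussian H).prod (ProbabilityTheory.stdGaussian H)) := by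
        refine lintegral_mono fun p => ?_
        rw [← ENNReal.ofReal_mul (exp_pos _).le, ← exp_add]
        refine ENNReal.ofReal_le_ofReal (exp_le_exp.2 ?_)
        have a1 := abs_le.1 (h3 p.1)
        have a2 := abs_le.1 (h3 p.2)
        linarith
    _ ≤ _ := by
        rw [lintegral_const_mul' _ _ ENNReal.ofReal_ne_top, exp_add, ENNReal.ofReal_mul (exp_pos _).le]
        gcongr
        exact gc_C1 h1 h2

/-- Chernoff bound -/
lemma gc_markov {α : Type*} [MeasurableSpace α] (ν : Measure α) {g : α → ℝ} (hg : Measurable g)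
    {K : ℝ≥0} (hK0 : 0 < K) {t : ℝ} (ht : 0 ≤ t)
    (hm : ∀ l : ℝ≥0, ∫⁻ p, ENNReal.ofReal (exp (l * g p)) ∂ν
      ≤ ENNReal.ofReal (exp (1 + π ^ 2 * ((l * K : ℝ≥0) : ℝ) ^ 2 / 8))) :
    ν {p | t ≤ g p} ≤ ENNReal.ofReal (3 * exp (-(t ^ 2 / (8 * K ^ 2)))) := by
  have hK0' : (0:ℝ) < K := hK0
  set l : ℝ≥0 := ⟨t / (4 * K ^ 2), by positivity⟩ with hl
  have hlv : (l : ℝ) = t / (4 * K ^ 2) := rfl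
  have hm := hm l
  have hmk := mul_meas_ge_le_lintegral₀ (μ := ν)
    (f := fun p => ENNReal.ofReal (exp ((l:ℝ) * g p))) (by fun_prop)
    (ENNReal.ofReal (exp (l * t)))
  have hsub : {p | t ≤ g p} ⊆ {p | ENNReal.ofReal (exp (l * t)) ≤
      ENNReal.ofReal (exp ((l:ℝ) * g p))} := by
    intro p hp
    have hp' : t ≤ g p := hp
    refine ENNReal.ofReal_le_ofReal (exp_le_exp.2 ?_)
    exact mul_le_mul_of_nonneg_left hp' l.2
  have hfin := (mul_le_mul_right (measure_mono hsub) (ENNReal.ofReal (exp (l * t)))).trans (hmk.trans hm)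
  rw [← ENNReal.mul_le_mul_iff_right (a := ENNReal.ofReal (exp (l * t))) (by simp [exp_pos]) (by simp)]
  refine hfin.trans ?_
  rw [← ENNReal.ofReal_mul (exp_pos _).le]
  refine ENNReal.ofReal_le_ofReal ?_
  have h3 : exp (1 + π ^ 2 * ((l * K : ℝ≥0) : ℝ) ^ 2 / 8) ≤ exp 1 * exp (t ^ 2 / (8 * K ^ 2)) := by
    rw [← exp_add]
    refine exp_le_exp.2 ?_
    push_cast
    have : π ^ 2 ≤ 16 := by nlinarith [pi_le_four, pi_pos]
    have h5 : π ^ 2 * ((l:ℝ) * K) ^ 2 / 8 ≤ 16 * ((l:ℝ) * K) ^ 2 / 8 := by gcongr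
    have h6 : 16 * ((l:ℝ) * K) ^ 2 / 8 = t ^ 2 / (8 * K ^ 2) := by
      rw [hlv]; field_simp; ring
    linarith
  refine h3.trans ?_
  have h7 : exp (l * t) * (3 * exp (-(t ^ 2 / (8 * K ^ 2)))) = 3 * exp (t ^ 2 / (8 * K ^ 2)) := by
    rw [mul_left_comm, ← exp_add]
    congr 2
    rw [hlv]; field_simp; ring
  rw [h7]
  gcongr
  exact exp_one_lt_three.le

set_option linter.unusedSectionVars false in
lemma gc_lip_mul {F : H → ℝ} {K : ℝ≥0} (hK : LipschitzWith K F) (l : ℝ≥0) :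
    LipschitzWith (l * K) (fun x => (l:ℝ) * F x) := by
  refine LipschitzWith.of_dist_le_mul fun x y => ?_
  have := hK.dist_le_mul x y
  rw [Real.dist_eq] at this ⊢
  rw [← mul_sub, abs_mul, abs_of_nonneg l.coe_nonneg]
  push_cast
  rw [mul_assoc]
  gcongr

/-- pair deviation bound -/
lemma gc_pair {F : H → ℝ} {K : ℝ≥0} (hK0 : 0 < K) (hK : LipschitzWith K F) {t : ℝ} (ht : 0 ≤ t) :
    ((ProbabilityTheory.stdGaussian H).prod (ProbabilityTheory.stdGaussian H))
      {p | t ≤ F p.1 - F p.2} ≤ ENNReal.ofReal (3 * exp (-(t ^ 2 / (8 * K ^ 2)))) := by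
  have hF := hK.continuous
  refine gc_markov _ (by fun_prop) hK0 ht fun l => ?_
  have := gc_lip (gc_lip_mul hK l)
  simp only [mul_sub]
  exact this

/-- deviation above the mean, bounded functions -/
lemma gc_mean {F : H → ℝ} {K : ℝ≥0} (hK0 : 0 < K) (hK : LipschitzWith K F) {t : ℝ} (ht : 0 ≤ t)
    (hb : ∀ x, |F x| ≤ 1) :
    (ProbabilityTheory.stdGaussian H)
      {x | t ≤ F x - ∫ y, F y ∂(ProbabilityTheory.stdGaussian H)}
      ≤ ENNReal.ofReal (3 * exp (-(t ^ 2 / (8 * K ^ 2)))) := by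
  have hF := hK.continuous
  set γ := ProbabilityTheory.stdGaussian H
  have hFi : Integrable F γ := Integrable.of_bound hF.aestronglyMeasurable 1
    (Filter.Eventually.of_forall hb)
  refine gc_markov _ (by fun_prop) hK0 ht fun l => ?_
  have h1 := gc_lip (gc_lip_mul hK l)
  rw [lintegral_prod _ (by fun_prop)] at h1
  refine le_trans (lintegral_mono fun x => ?_) h1
  have hb2 : ∀ y, |(l:ℝ) * F x - l * F y| ≤ l * 2 := by
    intro y
    rw [← mul_sub, abs_mul, abs_of_nonneg l.coe_nonneg]
    gcongr
    have a1 := abs_le.1 (hb x)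
    have a2 := abs_le.1 (hb y)
    rw [abs_le]; constructor <;> linarith
  have hei : Integrable (fun y => exp ((l:ℝ) * F x - l * F y)) γ := by
    refine Integrable.of_bound (by fun_prop) (exp (l * 2)) (Filter.Eventually.of_forall fun y => ?_)
    rw [Real.norm_of_nonneg (exp_pos _).le]
    exact exp_le_exp.2 ((abs_le.1 (hb2 y)).2)
  rw [← ofReal_integral_eq_lintegral_ofReal hei (Filter.Eventually.of_forall fun x => (exp_pos _).le)]
  refine ENNReal.ofReal_le_ofReal ?_
  have hJ := ConvexOn.map_integral_le (μ := γ) (s := Set.univ) (g := exp)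
    (f := fun y => (l:ℝ) * F x - l * F y) convexOn_exp Real.continuous_exp.continuousOn isClosed_univ
    (by simp) ((integrable_const _).sub (hFi.const_mul _)) hei
  rw [integral_sub (integrable_const _) (hFi.const_mul _)] at hJ
  simp only [integral_const, probReal_univ, one_smul] at hJ
  rw [integral_const_mul] at hJ
  rw [mul_sub]
  exact hJ

/-- deviation above a (quasi-)median -/
lemma gc_median {F : H → ℝ} {K : ℝ≥0} (hK0 : 0 < K) (hK : LipschitzWith K F) {t m : ℝ} (ht : 0 ≤ t)
    (hm : 1 / 2 ≤ (ProbabilityTheory.stdGaussian H) {x | F x ≤ m}) :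
    (ProbabilityTheory.stdGaussian H) {x | m + t ≤ F x}
      ≤ ENNReal.ofReal (6 * exp (-(t ^ 2 / (8 * K ^ 2)))) := by
  have hF := hK.continuous
  have h1 := gc_pair hK0 hK ht
  have hsub : {x | m + t ≤ F x} ×ˢ {x | F x ≤ m} ⊆ {p : H × H | t ≤ F p.1 - F p.2} := by
    rintro p ⟨hp1, hp2⟩
    have hp1' : m + t ≤ F p.1 := hp1
    have hp2' : F p.2 ≤ m := hp2
    show t ≤ F p.1 - F p.2
    linarith
  have h2 := (measure_mono hsub).trans h1
  rw [Measure.prod_prod] at h2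
  set A := (ProbabilityTheory.stdGaussian H) {x | m + t ≤ F x}
  have h3 : A * (1 / 2) ≤ ENNReal.ofReal (3 * exp (-(t ^ 2 / (8 * K ^ 2)))) := by
    refine le_trans ?_ h2
    gcongr
  calc A = 2 * (A * (1/2)) := by
        rw [mul_comm A, ← mul_assoc, one_div, ENNReal.mul_inv_cancel (by simp) (by simp), one_mul]
    _ ≤ 2 * ENNReal.ofReal (3 * exp (-(t ^ 2 / (8 * K ^ 2)))) := by gcongr
    _ = _ := by
      rw [show (2:ℝ≥0∞) = ENNReal.ofReal 2 by simp, ← ENNReal.ofReal_mul (by norm_num)]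
      congr 1; ring

end GaussConc

section Net

lemma net_card {k : ℕ} {R η : ℝ} (hR : 0 ≤ R) (hη : 0 < η)
    (S : Finset (EuclideanSpace ℝ (Fin k)))
    (hS : ∀ s ∈ S, ‖s‖ ≤ R) (hsep : ∀ s ∈ S, ∀ t ∈ S, s ≠ t → η < dist s t) :
    (S.card : ℝ) ≤ (1 + 2 * R / η) ^ k := by
  classical
  let V := EuclideanSpace ℝ (Fin k)
  have hdisj : Set.PairwiseDisjoint (S : Set V) fun s => Metric.ball s (η / 2) := by
    intro s hs t ht hst
    refine Metric.ball_disjoint_ball ?_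
    linarith [hsep s hs t ht hst]
  have hsub : (⋃ s ∈ S, Metric.ball s (η / 2)) ⊆ Metric.ball (0 : V) (R + η / 2) := by
    intro x hx
    simp only [Set.mem_iUnion] at hx
    obtain ⟨s, hs, hx⟩ := hx
    rw [Metric.mem_ball] at hx ⊢
    calc dist x 0 ≤ dist x s + dist s 0 := dist_triangle _ _ _
      _ < R + η / 2 := by rw [dist_zero_right]; linarith [hS s hs]
  have h1 := measure_mono (μ := (volume : Measure V)) hsub
  rw [measure_biUnion_finset hdisj (fun _ _ => measurableSet_ball)] at h1
  have hfin : Module.finrank ℝ V = k := by simp [V]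
  have hb : ∀ s : V, (volume : Measure V) (Metric.ball s (η / 2))
      = ENNReal.ofReal ((η / 2) ^ k) * volume (Metric.ball (0 : V) 1) := by
    intro s
    rw [Measure.addHaar_ball_of_pos _ _ (by positivity), hfin]
  simp only [hb] at h1
  rw [Measure.addHaar_ball_of_pos _ (0 : V) (r := R + η / 2) (by positivity), hfin, Finset.sum_const, nsmul_eq_mul,
    ← mul_assoc] at h1
  have h0 : (volume : Measure V) (Metric.ball (0 : V) 1) ≠ 0 := (Metric.measure_ball_pos _ _ one_pos).ne'
  have h2 := (ENNReal.mul_le_mul_iff_left h0 measure_ball_lt_top.ne).1 h1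
  rw [← ENNReal.ofReal_natCast, ← ENNReal.ofReal_mul (by positivity),
    ENNReal.ofReal_le_ofReal_iff (by positivity)] at h2
  have h3 : (1 + 2 * R / η) ^ k = (R + η / 2) ^ k / (η / 2) ^ k := by
    rw [← div_pow]; congr 1; field_simp; ring
  rw [h3, le_div_iff₀ (by positivity)]
  exact h2

lemma net_points (k : ℕ) {R η : ℝ} (hR : 0 ≤ R) (hη : 0 < η) :
    ∃ S : Finset (EuclideanSpace ℝ (Fin k)), (S.card : ℝ) ≤ (1 + 2 * R / η) ^ k ∧
      ∀ x, ‖x‖ ≤ R → ∃ s ∈ S, dist x s ≤ η := by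
  classical
  let p : ℕ → Prop := fun n => ∃ S : Finset (EuclideanSpace ℝ (Fin k)), S.card = n ∧
    (∀ s ∈ S, ‖s‖ ≤ R) ∧ (∀ s ∈ S, ∀ t ∈ S, s ≠ t → η < dist s t)
  have hp0 : p 0 := ⟨∅, by simp⟩
  have hbd : ∀ n, p n → n ≤ ⌊(1 + 2 * R / η) ^ k⌋₊ := by
    rintro n ⟨S, rfl, h1, h2⟩
    exact Nat.le_floor (net_card hR hη S h1 h2)
  obtain ⟨S, hc, h1, h2⟩ := Nat.findGreatest_spec (P := p) (Nat.zero_le ⌊(1 + 2 * R / η) ^ k⌋₊) hp0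
  refine ⟨S, net_card hR hη S h1 h2, fun x hx => ?_⟩
  by_contra hcon
  push Not at hcon
  have hxS : x ∉ S := fun h => by
    have := hcon x h
    rw [dist_self] at this
    linarith
  have hp : p (S.card + 1) := by
    refine ⟨insert x S, Finset.card_insert_of_notMem hxS, ?_, ?_⟩
    · intro s hs
      rcases Finset.mem_insert.1 hs with rfl | hs
      · exact hx
      · exact h1 s hs
    · intro s hs t ht hst
      rcases Finset.mem_insert.1 hs with hs' | hs' <;> rcases Finset.mem_insert.1 ht with ht' | ht'
      · exact absurd (hs'.trans ht'.symm) hst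
      · rw [hs']; exact hcon t ht'
      · rw [ht', dist_comm]; exact hcon s hs'
      · exact h2 s hs' t ht' hst
  have := Nat.le_findGreatest (P := p) (hbd _ hp) hp
  omega

/-- A finite family of bounded Lipschitz functions. -/
lemma net_functions (k : ℕ) {R η : ℝ} (hR : 0 ≤ R) (hη : 0 < η) :
    ∃ 𝓖 : Finset (EuclideanSpace ℝ (Fin k) → ℝ),
      (∀ g ∈ 𝓖, (∀ x, |g x| ≤ 1) ∧ LipschitzWith 1 g) ∧
      ((𝓖.card : ℝ) ≤ (2 / η + 1) ^ ((1 + 2 * R / η) ^ k)) ∧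
      ∀ f : EuclideanSpace ℝ (Fin k) → ℝ, (∀ x, |f x| ≤ 1) → LipschitzWith 1 f →
        ∃ g ∈ 𝓖, ∀ x, ‖x‖ ≤ R → |f x - g x| ≤ 3 * η := by
  classical
  obtain ⟨S, hScard, hS⟩ := net_points k hR hη
  let n : ℕ := ⌊2 / η⌋₊
  let A : Set (EuclideanSpace ℝ (Fin k) → ℝ) := {f | (∀ x, |f x| ≤ 1) ∧ LipschitzWith 1 f}
  -- quantization
  have hq : ∀ (f : A) (s : S), ⌊(f.1 s + 1) / η⌋₊ < n + 1 := by
    intro f s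
    refine Nat.lt_succ_of_le (Nat.floor_mono ?_)
    gcongr
    linarith [(abs_le.1 (f.2.1 s)).2]
  let Q : A → (S → Fin (n + 1)) := fun f s => ⟨⌊(f.1 s + 1) / η⌋₊, hq f s⟩
  let sel : (Set.range Q) → A := fun q => q.2.choose
  have hsel : ∀ q : Set.range Q, Q (sel q) = q.1 := fun q => q.2.choose_spec
  let 𝓖 : Finset (EuclideanSpace ℝ (Fin k) → ℝ) :=
    (Finset.univ : Finset (Set.range Q)).image fun q => (sel q).1
  refine ⟨𝓖, ?_, ?_, ?_⟩
  · intro g hg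
    obtain ⟨q, -, rfl⟩ := Finset.mem_image.1 hg
    exact (sel q).2
  · have h1 : 𝓖.card ≤ (n + 1) ^ S.card := by
      refine Finset.card_image_le.trans ?_
      rw [Finset.card_univ]
      refine (Fintype.card_subtype_le _).trans ?_
      simp
    have h2 : (1:ℝ) ≤ (n:ℝ) + 1 := by linarith [(Nat.cast_nonneg n : (0:ℝ) ≤ n)]
    have h3 : (n:ℝ) + 1 ≤ 2 / η + 1 := by
      gcongr; exact Nat.floor_le (by positivity)
    calc (𝓖.card : ℝ) ≤ ((n:ℝ) + 1) ^ S.card := by exact_mod_cast h1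
      _ = ((n:ℝ) + 1) ^ (S.card : ℝ) := by rw [Real.rpow_natCast]
      _ ≤ ((n:ℝ) + 1) ^ ((1 + 2 * R / η) ^ k) := Real.rpow_le_rpow_of_exponent_le h2 hScard
      _ ≤ _ := Real.rpow_le_rpow (by positivity) h3 (by positivity)
  · intro f hf1 hf2
    let fA : A := ⟨f, hf1, hf2⟩
    let q : Set.range Q := ⟨Q fA, fA, rfl⟩
    refine ⟨(sel q).1, Finset.mem_image.2 ⟨q, Finset.mem_univ _, rfl⟩, fun x hx => ?_⟩
    obtain ⟨s, hs, hxs⟩ := hS x hx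
    have hQ : Q (sel q) = Q fA := hsel q
    have hfl : ⌊((sel q).1 s + 1) / η⌋₊ = ⌊(f s + 1) / η⌋₊ := by
      have := congrFun hQ ⟨s, hs⟩
      exact congrArg Fin.val this
    set g := (sel q).1 with hg
    obtain ⟨hg1, hg2⟩ := (sel q).2
    rw [← hg] at hg1 hg2
    have a1 : |f s - g s| ≤ η := by
      have p1 : 0 ≤ (g s + 1) / η := div_nonneg (by linarith [(abs_le.1 (hg1 s)).1]) hη.le
      have p2 : 0 ≤ (f s + 1) / η := div_nonneg (by linarith [(abs_le.1 (hf1 s)).1]) hη.le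
      have b1 := Nat.floor_le p1
      have b2 := Nat.lt_floor_add_one ((g s + 1) / η)
      have b3 := Nat.floor_le p2
      have b4 := Nat.lt_floor_add_one ((f s + 1) / η)
      rw [hfl] at b1 b2
      have c1 : (f s + 1) / η - (g s + 1) / η ≤ 1 := by linarith
      have c2 : (g s + 1) / η - (f s + 1) / η ≤ 1 := by linarith
      rw [← sub_div, div_le_one hη] at c1 c2
      rw [abs_le]; constructor <;> linarith
    have a2 : |f x - f s| ≤ η := by
      have := hf2.dist_le_mul x s
      rw [Real.dist_eq] at this
      simp only [NNReal.coe_one, one_mul] at this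
      exact this.trans hxs
    have a3 : |g x - g s| ≤ η := by
      have := hg2.dist_le_mul x s
      rw [Real.dist_eq] at this
      simp only [NNReal.coe_one, one_mul] at this
      exact this.trans hxs
    rw [abs_le] at *
    constructor <;> linarith [a1.1, a1.2, a2.1, a2.2, a3.1, a3.2]

end Net

noncomputable section HaarPart

lemma stiefel_transitive {d k : ℕ} (hkd : k ≤ d) (θ₀ θ : Stiefel d k) :
    ∃ U : EuclideanSpace ℝ (Fin d) ≃ₗᵢ[ℝ] EuclideanSpace ℝ (Fin d), stiefelRotate U θ₀ = θ := by
  have key : ∀ θ : Stiefel d k, ∃ b : OrthonormalBasis (Fin d) ℝ (EuclideanSpace ℝ (Fin d)),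
      ∀ i : Fin k, b (Fin.castLE hkd i) = θ.1 i := by
    intro θ
    let v : Fin d → EuclideanSpace ℝ (Fin d) := fun i => if h : i.1 < k then θ.1 ⟨i.1, h⟩ else 0
    have hv : Orthonormal ℝ (Set.domRestrict {i : Fin d | i.1 < k} v) := by
      have : Set.domRestrict {i : Fin d | i.1 < k} v
          = θ.1 ∘ (fun i : {i : Fin d | i.1 < k} => (⟨i.1.1, i.2⟩ : Fin k)) := by
        funext i
        have hi : i.1.1 < k := i.2
        simp [v, hi]
      rw [this]
      refine θ.2.comp _ ?_
      intro i j hij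
      simp only [Fin.mk.injEq] at hij
      exact Subtype.ext (Fin.ext hij)
    obtain ⟨b, hb⟩ := Orthonormal.exists_orthonormalBasis_extension_of_card_eq (by simp) hv
    refine ⟨b, fun i => ?_⟩
    rw [hb _ (by simp)]
    simp [v]
  obtain ⟨b₀, h₀⟩ := key θ₀
  obtain ⟨b, h⟩ := key θ
  refine ⟨b₀.equiv b (Equiv.refl _), Subtype.ext (funext fun i => ?_)⟩
  show (b₀.equiv b (Equiv.refl _)) (θ₀.1 i) = θ.1 i
  rw [← h₀ i, OrthonormalBasis.equiv_apply_basis, ← h i]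
  rfl

abbrev OrthoGrp (d : ℕ) := unitary (EuclideanSpace ℝ (Fin d) →L[ℝ] EuclideanSpace ℝ (Fin d))

instance orthoContinuousStar (d : ℕ) :
    ContinuousStar (EuclideanSpace ℝ (Fin d) →L[ℝ] EuclideanSpace ℝ (Fin d)) :=
  ⟨(ContinuousLinearMap.adjoint (𝕜 := ℝ) (E := EuclideanSpace ℝ (Fin d))
    (F := EuclideanSpace ℝ (Fin d))).continuous⟩

instance orthoTopGroup (d : ℕ) : IsTopologicalGroup (OrthoGrp d) := inferInstance

instance orthoCompact (d : ℕ) : CompactSpace (OrthoGrp d) := by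
  refine (isCompact_iff_compactSpace (s := ((unitary (EuclideanSpace ℝ (Fin d) →L[ℝ] EuclideanSpace ℝ (Fin d)) :
    Submonoid _) : Set (EuclideanSpace ℝ (Fin d) →L[ℝ] EuclideanSpace ℝ (Fin d))))).1 ?_
  refine Metric.isCompact_of_isClosed_isBounded ?_ ?_
  · exact isClosed_unitary
  · refine (Metric.isBounded_closedBall (x := 0) (r := 1)).subset fun u hu => ?_
    rw [mem_closedBall_zero_iff]
    refine ContinuousLinearMap.opNorm_le_bound _ zero_le_one fun x => ?_
    rw [one_mul]
    exact ((Unitary.linearIsometryEquiv ⟨u, hu⟩).norm_map x).le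

/-- action of the orthogonal group on frames -/
def orthoAct {d k : ℕ} (u : OrthoGrp d) (θ : Stiefel d k) : Stiefel d k :=
  stiefelRotate (Unitary.linearIsometryEquiv u) θ

lemma orthoAct_mul {d k : ℕ} (u v : OrthoGrp d) (θ : Stiefel d k) :
    orthoAct (u * v) θ = orthoAct u (orthoAct v θ) := by
  simp only [orthoAct, map_mul]
  rfl

lemma measurable_orthoAct {d k : ℕ} :
    Measurable fun p : OrthoGrp d × Stiefel d k => orthoAct p.1 p.2 := by
  refine Measurable.subtype_mk ?_
  refine measurable_pi_lambda _ fun i => ?_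
  have h1 : Continuous fun q : (EuclideanSpace ℝ (Fin d) →L[ℝ] EuclideanSpace ℝ (Fin d)) ×
      EuclideanSpace ℝ (Fin d) => q.1 q.2 := by fun_prop
  refine h1.measurable.comp (Measurable.prodMk ?_ ?_)
  · exact measurable_subtype_coe.comp measurable_fst
  · exact (measurable_pi_apply i).comp (measurable_subtype_coe.comp measurable_snd)

set_option maxHeartbeats 1000000 in
lemma haar_transfer {d k : ℕ} (hkd : k ≤ d) (μ : Measure (Stiefel d k)) (hμ : IsHaarStiefel μ)
    {α : Type*} [MeasurableSpace α] (γ : Measure α) [IsProbabilityMeasure γ]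
    (s : α → Stiefel d k) (hs : Measurable s) {B : Set (Stiefel d k)} (hB : MeasurableSet B)
    (c : ℝ≥0∞)
    (hc : ∀ U : EuclideanSpace ℝ (Fin d) ≃ₗᵢ[ℝ] EuclideanSpace ℝ (Fin d),
      γ {a | stiefelRotate U (s a) ∈ B} ≤ c) : μ B ≤ c := by
  obtain ⟨hμp, hinv⟩ := hμ
  let K₀ : TopologicalSpace.PositiveCompacts (OrthoGrp d) := ⊤
  let ν : Measure (OrthoGrp d) := Measure.haarMeasure K₀
  have hν : IsProbabilityMeasure ν := ⟨by
    have := Measure.haarMeasure_self (K₀ := K₀)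
    simpa [K₀] using this⟩
  have hact : Measurable fun p : OrthoGrp d × Stiefel d k => orthoAct p.1⁻¹ p.2 :=
    measurable_orthoAct.comp ((measurable_inv.comp measurable_fst).prodMk measurable_snd)
  have hactu : ∀ u : OrthoGrp d, Measurable fun θ : Stiefel d k => orthoAct u θ := fun u =>
    measurable_orthoAct.comp (measurable_const.prodMk measurable_id)
  have hS : MeasurableSet {p : OrthoGrp d × Stiefel d k | orthoAct p.1⁻¹ p.2 ∈ B} := hact hB
  let Φ : Stiefel d k → ℝ≥0∞ := fun θ => ν {u | orthoAct u⁻¹ θ ∈ B}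
  have h1 : μ B = ∫⁻ θ, Φ θ ∂μ := by
    have e1 : (ν.prod μ) {p : OrthoGrp d × Stiefel d k | orthoAct p.1⁻¹ p.2 ∈ B} = μ B := by
      rw [Measure.prod_apply hS]
      have : ∀ u : OrthoGrp d, μ (Prod.mk u ⁻¹' {p : OrthoGrp d × Stiefel d k | orthoAct p.1⁻¹ p.2 ∈ B})
          = μ B := by
        intro u
        have := hinv (Unitary.linearIsometryEquiv u⁻¹)
        conv_rhs => rw [← this]
        exact (Measure.map_apply (hactu u⁻¹) hB).symm
      rw [lintegral_congr this]
      simp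
    rw [← e1, Measure.prod_apply_symm hS]
    rfl
  have h2 : ∀ θ θ₀, Φ θ = Φ θ₀ := by
    intro θ θ₀
    obtain ⟨U, hU⟩ := stiefel_transitive hkd θ₀ θ
    let v : OrthoGrp d := Unitary.linearIsometryEquiv.symm U
    have hv : orthoAct v θ₀ = θ := by
      simp only [orthoAct, v, MulEquiv.apply_symm_apply]
      exact hU
    have e := measure_preimage_mul ν v⁻¹ {u | orthoAct u⁻¹ θ₀ ∈ B}
    rw [← hv]
    simp only [Φ]
    rw [← e]
    congr 1
    ext u
    simp [orthoAct_mul]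
  have h3 : ∀ θ, μ B = Φ θ := by
    intro θ
    rw [h1, lintegral_congr (fun θ' => h2 θ' θ)]
    simp
  have hS' : MeasurableSet {p : OrthoGrp d × α | orthoAct p.1⁻¹ (s p.2) ∈ B} :=
    (hact.comp (measurable_fst.prodMk (hs.comp measurable_snd))) hB
  calc μ B = ∫⁻ a, Φ (s a) ∂γ := by
        rw [lintegral_congr (fun a => (h3 (s a)).symm)]; simp
    _ = (ν.prod γ) {p : OrthoGrp d × α | orthoAct p.1⁻¹ (s p.2) ∈ B} := by
        rw [Measure.prod_apply_symm hS']; rfl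
    _ ≤ c := by
        rw [Measure.prod_apply hS']
        refine (lintegral_mono (g := fun _ => c) fun u => ?_).trans (by simp)
        exact hc (Unitary.linearIsometryEquiv u⁻¹)

end HaarPart

section GaussMap

lemma gauss_map_scaled {H F : Type*} [NormedAddCommGroup H] [InnerProductSpace ℝ H]
    [FiniteDimensional ℝ H] [MeasurableSpace H] [BorelSpace H]
    [NormedAddCommGroup F] [InnerProductSpace ℝ F]
    [FiniteDimensional ℝ F] [MeasurableSpace F] [BorelSpace F]
    (T : H → F) (hT : Measurable T) (S : F → H) (r : ℝ)
    (hTS : ∀ h y, ⟪T h, y⟫ = ⟪h, S y⟫) (hS : ∀ y, ‖S y‖ ^ 2 = r ^ 2 * ‖y‖ ^ 2) :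
    (ProbabilityTheory.stdGaussian H).map T
      = (ProbabilityTheory.stdGaussian F).map (fun z => r • z) := by
  have : IsProbabilityMeasure ((ProbabilityTheory.stdGaussian H).map T) :=
    Measure.isProbabilityMeasure_map hT.aemeasurable
  have hm : Measurable (fun z : F => r • z) := by fun_prop
  have : IsProbabilityMeasure ((ProbabilityTheory.stdGaussian F).map (fun z => r • z)) :=
    Measure.isProbabilityMeasure_map hm.aemeasurable
  apply Measure.ext_of_charFun
  funext y
  rw [charFun_map_smul, charFun_stdGaussian, charFun_apply, integral_map hT.aemeasurable]
  · simp_rw [hTS]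
    rw [← charFun_apply, charFun_stdGaussian]
    congr 2
    rw [norm_smul, ← Complex.ofReal_pow, ← Complex.ofReal_pow, hS, mul_pow, Real.norm_eq_abs, sq_abs]
  · apply Measurable.aestronglyMeasurable
    fun_prop

lemma stdGaussian_eq (k : ℕ) :
    _root_.stdGaussian k = ProbabilityTheory.stdGaussian (EuclideanSpace ℝ (Fin k)) := by
  rw [← map_pi_eq_stdGaussian]
  rfl


lemma gauss_one_sq : ∫ x, x ^ 2 ∂(gaussianReal 0 1) = 1 := by
  have h := variance_fun_id_gaussianReal (μ := 0) (v := 1)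
  rw [variance_of_integral_eq_zero (by fun_prop) (by simp)] at h
  simpa using h

lemma gauss_one_memLp : MemLp (fun x : ℝ => x ^ 2) 2 (gaussianReal 0 1) := by
  have h := memLp_id_gaussianReal' (μ := 0) (v := 1) 4 (by simp)
  rw [memLp_two_iff_integrable_sq (by fun_prop)]
  have := h.integrable_norm_pow (p := 4) (by norm_num)
  refine this.congr (ae_of_all _ fun x => ?_)
  simp only [id, Real.norm_eq_abs]
  rw [Even.pow_abs ⟨2, rfl⟩]; ring

lemma gauss_one_var : Var[fun x : ℝ => x ^ 2; gaussianReal 0 1] ≤ 80 := by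
  refine (variance_le_expectation_sq (by fun_prop)).trans ?_
  have hm := mgf_id_gaussianReal (μ := 0) (v := 1)
  have hi1 := integrable_exp_mul_gaussianReal (μ := 0) (v := 1) 1
  have hi2 := integrable_exp_mul_gaussianReal (μ := 0) (v := 1) (-1)
  have h1 : ∫ x, exp (1 * x) ∂(gaussianReal 0 1) = exp (1/2) := by
    have := congrFun hm 1
    simpa [mgf] using this
  have h2 : ∫ x, exp (-1 * x) ∂(gaussianReal 0 1) = exp (1/2) := by
    have := congrFun hm (-1)
    simpa [mgf] using this
  have key : ∫ x, ((fun x : ℝ => x ^ 2) ^ 2) x ∂(gaussianReal 0 1)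
      ≤ ∫ x, 24 * (exp (1 * x) + exp (-1 * x)) ∂(gaussianReal 0 1) := by
    refine integral_mono ?_ ((hi1.add hi2).const_mul 24) fun x => ?_
    · exact (memLp_two_iff_integrable_sq (by fun_prop)).1 gauss_one_memLp
    · have := Real.pow_div_factorial_le_exp |x| (abs_nonneg x) 4
      have h3 : exp |x| ≤ exp (1 * x) + exp (-1 * x) := by
        rcases abs_cases x with ⟨h, _⟩ | ⟨h, _⟩ <;> rw [h] <;> simp <;> positivity
      have h4 : |x| ^ 4 = x ^ 4 := Even.pow_abs ⟨2, rfl⟩ x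
      rw [h4] at this
      simp [Nat.factorial] at this ⊢
      simp at h3
      nlinarith
  refine key.trans ?_
  rw [integral_const_mul, integral_add hi1 hi2, h1, h2]
  have : exp (1/2) ≤ 5/3 := by
    have h := Real.exp_one_lt_d9
    have h2 : exp (1/2) ^ 2 = exp 1 := by rw [← Real.exp_nat_mul]; norm_num
    nlinarith [Real.exp_pos (1/2)]
  linarith

lemma gauss_norm_sq_memLp (d : ℕ) :
    MemLp (fun x => ‖x‖ ^ 2) 2 (ProbabilityTheory.stdGaussian (EuclideanSpace ℝ (Fin d))) := by
  rw [← map_pi_eq_stdGaussian, memLp_map_measure_iff (by fun_prop) (by fun_prop)]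
  have : ((fun x : EuclideanSpace ℝ (Fin d) => ‖x‖ ^ 2) ∘ WithLp.toLp 2)
      = ∑ i, fun ω : Fin d → ℝ => (ω i) ^ 2 := by
    funext ω
    simp [EuclideanSpace.norm_sq_eq]
  rw [this]
  refine memLp_finsetSum' _ fun i _ => ?_
  exact gauss_one_memLp.comp_measurePreserving (measurePreserving_eval (fun _ => gaussianReal 0 1) i)

lemma gauss_norm_sq_integral (d : ℕ) :
    ∫ x, ‖x‖ ^ 2 ∂(ProbabilityTheory.stdGaussian (EuclideanSpace ℝ (Fin d))) = d := by
  rw [← map_pi_eq_stdGaussian, integral_map (by fun_prop) (by fun_prop)]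
  simp only [EuclideanSpace.norm_sq_eq, Real.norm_eq_abs, sq_abs]
  rw [integral_finsetSum]
  · have : ∀ i : Fin d, ∫ a, (a i) ^ 2 ∂(Measure.pi fun _ : Fin d => gaussianReal 0 1) = 1 := by
      intro i
      have h := (measurePreserving_eval (fun _ : Fin d => gaussianReal 0 1) i)
      have h2 := integral_map (μ := Measure.pi fun _ : Fin d => gaussianReal 0 1) (f := fun x : ℝ => x ^ 2) h.measurable.aemeasurable (by fun_prop)
      rw [h.map_eq, gauss_one_sq] at h2
      exact h2.symm
    simp [this]
  · intro i _
    exact (gauss_one_memLp.comp_measurePreserving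
      (measurePreserving_eval (fun _ : Fin d => gaussianReal 0 1) i)).integrable (by norm_num)

lemma gauss_norm_sq_var (d : ℕ) :
    ∫ x, (‖x‖ ^ 2 - d) ^ 2 ∂(ProbabilityTheory.stdGaussian (EuclideanSpace ℝ (Fin d)))
      ≤ 80 * d := by
  have h1 : Var[fun x => ‖x‖ ^ 2; ProbabilityTheory.stdGaussian (EuclideanSpace ℝ (Fin d))]
      ≤ 80 * d := by
    rw [← map_pi_eq_stdGaussian, variance_map (by fun_prop) (by fun_prop)]
    have : ((fun x : EuclideanSpace ℝ (Fin d) => ‖x‖ ^ 2) ∘ WithLp.toLp 2)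
        = ∑ i, fun ω : Fin d → ℝ => (fun x : ℝ => x ^ 2) (ω i) := by
      funext ω
      simp [EuclideanSpace.norm_sq_eq]
    rw [this, variance_sum_pi (fun _ => gauss_one_memLp)]
    calc _ ≤ ∑ i : Fin d, (80 : ℝ) := Finset.sum_le_sum fun i _ => gauss_one_var
      _ = _ := by simp [mul_comm]
  rw [variance_eq_integral (by fun_prop), gauss_norm_sq_integral] at h1
  exact h1


lemma gauss_comb (d k : ℕ) (u : Fin k → ℝ) (hu : ∑ i, u i ^ 2 = 1) :
    (ProbabilityTheory.stdGaussian (PiLp 2 (fun _ : Fin k => EuclideanSpace ℝ (Fin d)))).map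
      (fun h => ∑ i, u i • h i) = ProbabilityTheory.stdGaussian (EuclideanSpace ℝ (Fin d)) := by
  rw [gauss_map_scaled _ (by fun_prop) (fun y => WithLp.toLp 2 (fun i => u i • y)) 1]
  · simp
  · intro h y
    simp [PiLp.inner_apply, sum_inner, inner_smul_left, inner_smul_right]
  · intro y
    rw [PiLp.norm_sq_eq_of_L2]
    simp [norm_smul, mul_pow, ← Finset.sum_mul, hu]

lemma gauss_comb_var (d k : ℕ) (u : Fin k → ℝ) (hu : ∑ i, u i ^ 2 = 1) :
    Integrable (fun h => (‖∑ i, u i • h i‖ ^ 2 - d) ^ 2)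
      (ProbabilityTheory.stdGaussian (PiLp 2 (fun _ : Fin k => EuclideanSpace ℝ (Fin d)))) ∧
    ∫ h, (‖∑ i, u i • h i‖ ^ 2 - d) ^ 2
      ∂(ProbabilityTheory.stdGaussian (PiLp 2 (fun _ : Fin k => EuclideanSpace ℝ (Fin d))))
      ≤ 80 * d := by
  have hg := gauss_comb d k u hu
  have hm : AEMeasurable (fun h : PiLp 2 (fun _ : Fin k => EuclideanSpace ℝ (Fin d)) =>
    ∑ i, u i • h i) (ProbabilityTheory.stdGaussian
      (PiLp 2 (fun _ : Fin k => EuclideanSpace ℝ (Fin d)))) := by fun_prop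
  constructor
  · have h1 : Integrable (fun x => (‖x‖ ^ 2 - (d : ℝ)) ^ 2)
        (ProbabilityTheory.stdGaussian (EuclideanSpace ℝ (Fin d))) :=
      ((gauss_norm_sq_memLp d).sub (memLp_const (d : ℝ))).integrable_sq
    rw [← hg, integrable_map_measure (by fun_prop) hm] at h1
    exact h1
  · have h1 := gauss_norm_sq_var d
    rw [← hg, integral_map hm (by fun_prop)] at h1
    exact h1

lemma gram_entry (d k : ℕ) (i j : Fin k) :
    Integrable (fun h => (⟪h i, h j⟫ - if i = j then (d : ℝ) else 0) ^ 2)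
      (ProbabilityTheory.stdGaussian (PiLp 2 (fun _ : Fin k => EuclideanSpace ℝ (Fin d)))) ∧
    ∫ h, (⟪h i, h j⟫ - if i = j then (d : ℝ) else 0) ^ 2
      ∂(ProbabilityTheory.stdGaussian (PiLp 2 (fun _ : Fin k => EuclideanSpace ℝ (Fin d))))
      ≤ 80 * d := by
  by_cases hij : i = j
  · subst hij
    have := gauss_comb_var d k (Pi.single i 1) (by simp [Pi.single_apply])
    simpa [Pi.single_apply, real_inner_self_eq_norm_sq] using this
  · have hs : (√2)⁻¹ ^ 2 = (1/2 : ℝ) := by rw [inv_pow, Real.sq_sqrt (by norm_num)]; norm_num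
    have hc : ∀ s : ℝ, s ^ 2 = 1 →
        ∑ m, (((√2)⁻¹ * (if m = i then 1 else 0) + s * (√2)⁻¹ * (if m = j then 1 else 0) : ℝ)) ^ 2
          = 1 := by
      intro s hss
      have : ∀ m : Fin k, (((√2)⁻¹ * (if m = i then 1 else 0)
          + s * (√2)⁻¹ * (if m = j then 1 else 0) : ℝ)) ^ 2
          = 1/2 * (if m = i then 1 else 0) + 1/2 * (if m = j then 1 else 0) := by
        intro m
        by_cases h1 : m = i
        · have : m ≠ j := fun h => hij (h1.symm.trans h)
          simp [h1, hij]
        · by_cases h2 : m = j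
          · have : j ≠ i := fun h => hij h.symm
            simp [h2, this, mul_pow, hss]
          · simp [h1, h2]
      simp_rw [this]
      rw [Finset.sum_add_distrib, ← Finset.mul_sum, ← Finset.mul_sum]
      simp
      norm_num
    have hp := gauss_comb_var d k _ (hc 1 (by norm_num))
    have hn := gauss_comb_var d k _ (hc (-1) (by norm_num))
    simp only [add_smul, mul_smul, Finset.sum_add_distrib, ← Finset.smul_sum, ite_smul, one_smul,
      zero_smul, Finset.sum_ite_eq', Finset.mem_univ, if_true, neg_smul, Finset.sum_neg_distrib] at hp hn
    have hexp : ∀ h : PiLp 2 (fun _ : Fin k => EuclideanSpace ℝ (Fin d)),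
        (⟪h i, h j⟫ - if i = j then (d : ℝ) else 0) ^ 2
        ≤ 1/2 * (‖(√2)⁻¹ • h i + (√2)⁻¹ • h j‖ ^ 2 - d) ^ 2
        + 1/2 * (‖(√2)⁻¹ • h i + -((√2)⁻¹ • h j)‖ ^ 2 - d) ^ 2 := by
      intro h
      rw [if_neg hij, ← sub_eq_add_neg, norm_add_sq_real, norm_sub_sq_real, norm_smul, norm_smul,
        inner_smul_left, inner_smul_right, mul_pow, mul_pow]
      simp only [Real.norm_eq_abs, sq_abs, conj_trivial]
      rw [hs]
      have : (√2)⁻¹ * ((√2)⁻¹ * ⟪h i, h j⟫) = 1/2 * ⟪h i, h j⟫ := by rw [← hs]; ring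
      rw [this]
      nlinarith [sq_nonneg (‖h i‖ ^ 2 / 2 + ‖h j‖ ^ 2 / 2 - d)]
    have hI := (hp.1.const_mul (1/2)).add (hn.1.const_mul (1/2))
    refine ⟨?_, ?_⟩
    · refine hI.mono (by fun_prop) (ae_of_all _ fun h => ?_)
      rw [Real.norm_eq_abs, Real.norm_eq_abs, abs_of_nonneg (sq_nonneg _)]
      exact (hexp h).trans (le_abs_self _)
    · refine (integral_mono_of_nonneg (ae_of_all _ fun h => sq_nonneg _) hI
        (ae_of_all _ hexp)).trans ?_
      simp only [Pi.add_apply]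
      rw [integral_add (hp.1.const_mul (1/2)) (hn.1.const_mul (1/2)), integral_const_mul,
        integral_const_mul]
      linarith [hp.2, hn.2]

lemma gram_half (d k : ℕ) (hd : 0 < d) (ε : ℝ) (hε : 0 < ε) (hk : 160 * (k : ℝ) ^ 2 ≤ d * ε ^ 2) :
    1 / 2 ≤ (ProbabilityTheory.stdGaussian (PiLp 2 (fun _ : Fin k => EuclideanSpace ℝ (Fin d))))
      {h | ∑ i, ∑ j, (⟪h i, h j⟫ - if i = j then (d : ℝ) else 0) ^ 2 ≤ (d * ε) ^ 2} := by
  set γ := ProbabilityTheory.stdGaussian (PiLp 2 (fun _ : Fin k => EuclideanSpace ℝ (Fin d)))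
  set Q : PiLp 2 (fun _ : Fin k => EuclideanSpace ℝ (Fin d)) → ℝ :=
    fun h => ∑ i, ∑ j, (⟪h i, h j⟫ - if i = j then (d : ℝ) else 0) ^ 2 with hQ
  have hd' : (0 : ℝ) < d := by exact_mod_cast hd
  have hQm : Measurable Q := by fun_prop
  have hQ0 : ∀ h, 0 ≤ Q h := fun h => Finset.sum_nonneg fun i _ => Finset.sum_nonneg fun j _ =>
    sq_nonneg _
  have hQi : Integrable Q γ := integrable_finsetSum _ fun i _ => integrable_finsetSum _ fun j _ =>
    (gram_entry d k i j).1
  have hQE : ∫ h, Q h ∂γ ≤ (k : ℝ) ^ 2 * (80 * d) := by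
    rw [hQ, integral_finsetSum _ fun i _ => integrable_finsetSum _ fun j _ => (gram_entry d k i j).1]
    calc _ ≤ ∑ i : Fin k, ∑ j : Fin k, (80 * d : ℝ) := by
          refine Finset.sum_le_sum fun i _ => ?_
          rw [integral_finsetSum _ fun j _ => (gram_entry d k i j).1]
          exact Finset.sum_le_sum fun j _ => (gram_entry d k i j).2
      _ = _ := by simp; ring
  have hmk := mul_meas_ge_le_integral_of_nonneg (ae_of_all γ hQ0) hQi ((d * ε) ^ 2)
  have hpos : 0 < (d * ε) ^ 2 := by positivity
  have hc : γ.real {h | (d * ε) ^ 2 ≤ Q h} ≤ 1/2 := by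
    by_contra hcon
    push Not at hcon
    have := (mul_lt_mul_of_pos_left hcon hpos).trans_le (hmk.trans hQE)
    nlinarith
  have hle : (1 : ℝ) / 2 ≤ γ.real {h | Q h ≤ (d * ε) ^ 2} := by
    have h1 : γ.real {h | (d * ε) ^ 2 ≤ Q h}ᶜ = 1 - γ.real {h | (d * ε) ^ 2 ≤ Q h} :=
      probReal_compl_eq_one_sub (measurableSet_le measurable_const hQm)
    have h2 : γ.real {h | (d * ε) ^ 2 ≤ Q h}ᶜ ≤ γ.real {h | Q h ≤ (d * ε) ^ 2} := by
      refine measureReal_mono ?_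
      intro h hh
      simp only [Set.mem_compl_iff, Set.mem_ofPred_eq, not_le] at hh ⊢
      exact hh.le
    linarith
  have := ENNReal.ofReal_le_ofReal hle
  rw [ofReal_measureReal] at this
  convert this using 1
  rw [ENNReal.ofReal_div_of_pos (by norm_num)]; simp

end GaussMap

section Polar

lemma hs_invariant {V F : Type*} [NormedAddCommGroup V] [InnerProductSpace ℝ V]
    [FiniteDimensional ℝ V] [NormedAddCommGroup F] [InnerProductSpace ℝ F]
    [FiniteDimensional ℝ F] {ι ι' : Type*} [Fintype ι] [Fintype ι']
    (b : OrthonormalBasis ι ℝ V) (b' : OrthonormalBasis ι' ℝ V) (T : V →ₗ[ℝ] F) :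
    ∑ i, ‖T (b i)‖ ^ 2 = ∑ i, ‖T (b' i)‖ ^ 2 := by
  have key : ∀ {κ : Type _} [Fintype κ] (c : OrthonormalBasis κ ℝ V),
      ∑ i, ‖T (c i)‖ ^ 2 = LinearMap.trace ℝ V (T.adjoint ∘ₗ T) := by
    intro κ _ c
    rw [LinearMap.trace_eq_sum_inner _ c]
    refine Finset.sum_congr rfl fun i _ => ?_
    rw [LinearMap.comp_apply, LinearMap.adjoint_inner_right, real_inner_self_eq_norm_sq]
  have key' : ∀ {κ : Type _} [Fintype κ] (c : OrthonormalBasis κ ℝ V),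
      ∑ i, ‖T (c i)‖ ^ 2 = LinearMap.trace ℝ V (T.adjoint ∘ₗ T) := by
    intro κ _ c
    rw [LinearMap.trace_eq_sum_inner _ c]
    refine Finset.sum_congr rfl fun i _ => ?_
    rw [LinearMap.comp_apply, LinearMap.adjoint_inner_right, real_inner_self_eq_norm_sq]
  rw [key b, key' b']

lemma polar_approx (d k : ℕ) (h : Fin k → EuclideanSpace ℝ (Fin d)) (ε : ℝ) (hε0 : 0 < ε)
    (hε1 : ε < 1)
    (hQ : ∑ i, ∑ j, (⟪h i, h j⟫ - if i = j then (1 : ℝ) else 0) ^ 2 ≤ ε ^ 2) :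
    ∃ θ : Stiefel d k, ∑ i, ‖h i - θ.1 i‖ ^ 2 ≤ ε ^ 2 := by
  let e : OrthonormalBasis (Fin k) ℝ (EuclideanSpace ℝ (Fin k)) := EuclideanSpace.basisFun (Fin k) ℝ
  let G : EuclideanSpace ℝ (Fin k) →ₗ[ℝ] EuclideanSpace ℝ (Fin d) := e.toBasis.constr ℝ h
  have hG : ∀ i, G (e i) = h i := fun i => by
    have := e.toBasis.constr_basis ℝ h i
    rwa [OrthonormalBasis.coe_toBasis] at this
  let A := G.adjoint ∘ₗ G
  have hA : A.IsSymmetric := by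
    intro x y
    simp only [A, LinearMap.comp_apply]
    rw [LinearMap.adjoint_inner_left, LinearMap.adjoint_inner_right]
  have hfr : Module.finrank ℝ (EuclideanSpace ℝ (Fin k)) = k := by simp
  let b := hA.eigenvectorBasis hfr
  let lam := hA.eigenvalues hfr
  have hb : ∀ m, A (b m) = lam m • b m := fun m => hA.apply_eigenvectorBasis hfr m
  have hww : ∀ m n, ⟪G (b m), G (b n)⟫ = if m = n then lam n else 0 := by
    intro m n
    rw [← LinearMap.adjoint_inner_right]
    change ⟪b m, A (b n)⟫ = _
    rw [hb, inner_smul_right, orthonormal_iff_ite.1 b.orthonormal]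
    split_ifs <;> simp
  have hsum : ∑ m, (lam m - 1) ^ 2 ≤ ε ^ 2 := by
    have h1 := hs_invariant b e (A - (LinearMap.id : EuclideanSpace ℝ (Fin k) →ₗ[ℝ] EuclideanSpace ℝ (Fin k)))
    have h2 : ∀ m, ‖(A - (LinearMap.id : EuclideanSpace ℝ (Fin k) →ₗ[ℝ] EuclideanSpace ℝ (Fin k))) (b m)‖ ^ 2 = (lam m - 1) ^ 2 := by
      intro m
      have : (A - (LinearMap.id : EuclideanSpace ℝ (Fin k) →ₗ[ℝ] EuclideanSpace ℝ (Fin k))) (b m) = (lam m - 1) • b m := by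
        simp [hb, sub_smul]
      rw [this, norm_smul, b.norm_eq_one]; simp
    have h3 : ∀ i, ‖(A - (LinearMap.id : EuclideanSpace ℝ (Fin k) →ₗ[ℝ] EuclideanSpace ℝ (Fin k))) (e i)‖ ^ 2
        = ∑ j, (⟪h i, h j⟫ - if i = j then (1 : ℝ) else 0) ^ 2 := by
      intro i
      rw [← e.sum_sq_norm_inner_right]
      refine Finset.sum_congr rfl fun j _ => ?_
      rw [LinearMap.sub_apply, inner_sub_right]
      simp only [A, LinearMap.comp_apply, LinearMap.id_apply]
      rw [LinearMap.adjoint_inner_right, hG, hG, orthonormal_iff_ite.1 e.orthonormal,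
        Real.norm_eq_abs, sq_abs, real_inner_comm]
      simp only [eq_comm]
    simp_rw [h2, h3] at h1
    rw [h1]; exact hQ
  have hlam : ∀ m, 0 < lam m := by
    intro m
    have h1 : (lam m - 1) ^ 2 ≤ ε ^ 2 :=
      (Finset.single_le_sum (f := fun m => (lam m - 1) ^ 2) (fun i _ => sq_nonneg _)
        (Finset.mem_univ m)).trans hsum
    have := abs_le_of_sq_le_sq h1 hε0.le
    linarith [(abs_le.1 this).1]
  let u : Fin k → EuclideanSpace ℝ (Fin d) := fun m => (√(lam m))⁻¹ • G (b m)
  have hu : Orthonormal ℝ u := by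
    rw [orthonormal_iff_ite]
    intro m n
    simp only [u, inner_smul_left, inner_smul_right, hww, conj_trivial]
    split_ifs with hmn
    · subst hmn
      have := Real.sq_sqrt (hlam m).le
      have h0 := Real.sqrt_pos.2 (hlam m)
      field_simp
      exact this.symm
    · simp
  let Θ : EuclideanSpace ℝ (Fin k) →ₗ[ℝ] EuclideanSpace ℝ (Fin d) := b.toBasis.constr ℝ u
  have hΘ : ∀ i, Θ (b i) = u i := fun i => by
    have := b.toBasis.constr_basis ℝ u i
    rwa [OrthonormalBasis.coe_toBasis] at this
  have hΘo : Orthonormal ℝ (Θ ∘ b.toBasis) := by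
    have : Θ ∘ b.toBasis = u := by funext i; simp [hΘ]
    rw [this]; exact hu
  let Θi := Θ.isometryOfOrthonormal (v := b.toBasis) (by simp) hΘo
  refine ⟨⟨fun i => Θi (e i), e.orthonormal.comp_linearIsometry Θi⟩, ?_⟩
  have h1 := hs_invariant b e (G - Θ)
  have h2 : ∀ m, ‖(G - Θ) (b m)‖ ^ 2 ≤ (lam m - 1) ^ 2 := by
    intro m
    have h0 := Real.sqrt_pos.2 (hlam m)
    have hsq := Real.sq_sqrt (hlam m).le
    have : (G - Θ) (b m) = (1 - (√(lam m))⁻¹) • G (b m) := by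
      simp [hΘ, u, sub_smul]
    rw [this, norm_smul, mul_pow, ← real_inner_self_eq_norm_sq (G (b m)), hww, if_pos rfl, Real.norm_eq_abs,
      sq_abs]
    have h3 : (1 - (√(lam m))⁻¹) ^ 2 * lam m = (√(lam m) - 1) ^ 2 := by
      nth_rw 2 [← hsq]
      field_simp
    rw [h3]
    nth_rw 2 [← hsq]
    have : (√(lam m) ^ 2 - 1) ^ 2 = (√(lam m) - 1) ^ 2 * (√(lam m) + 1) ^ 2 := by ring
    rw [this]
    nlinarith [sq_nonneg (√(lam m) - 1)]
  calc ∑ i, ‖h i - Θi (e i)‖ ^ 2 = ∑ i, ‖(G - Θ) (e i)‖ ^ 2 := by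
        refine Finset.sum_congr rfl fun i _ => ?_
        rw [LinearMap.sub_apply, hG]; rfl
    _ = ∑ m, ‖(G - Θ) (b m)‖ ^ 2 := h1.symm
    _ ≤ _ := (Finset.sum_le_sum fun m _ => h2 m).trans hsum

end Polar

section Near

lemma gauss_near (d k : ℕ) (hd : 0 < d) (ε : ℝ) (hε0 : 0 < ε)
    (hε1 : ε < 1) (hk : 160 * (k : ℝ) ^ 2 ≤ d * ε ^ 2) :
    ∃ s : PiLp 2 (fun _ : Fin k => EuclideanSpace ℝ (Fin d)) → Stiefel d k, Measurable s ∧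
      (ProbabilityTheory.stdGaussian (PiLp 2 (fun _ : Fin k => EuclideanSpace ℝ (Fin d))))
        {h | ¬ ‖h - √d • WithLp.toLp 2 (s h).1‖ < 2 * (√d * ε)}
      ≤ ENNReal.ofReal (6 * exp (-(d * ε ^ 2 / 8))) := by
  set γ := ProbabilityTheory.stdGaussian (PiLp 2 (fun _ : Fin k => EuclideanSpace ℝ (Fin d)))
    with hγ
  have hd' : (0 : ℝ) < d := by exact_mod_cast hd
  have hsd : 0 < √(d : ℝ) := Real.sqrt_pos.2 hd'
  have hsd2 : √(d : ℝ) ^ 2 = d := Real.sq_sqrt hd'.le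
  let K : Set (PiLp 2 (fun _ : Fin k => EuclideanSpace ℝ (Fin d))) :=
    Set.range fun θ : Stiefel d k => √d • WithLp.toLp 2 θ.1
  -- good event
  have hgood : ∀ h : PiLp 2 (fun _ : Fin k => EuclideanSpace ℝ (Fin d)),
      ∑ i, ∑ j, (⟪h i, h j⟫ - if i = j then (d : ℝ) else 0) ^ 2 ≤ (d * ε) ^ 2 →
      ∃ θ : Stiefel d k, ‖h - √d • WithLp.toLp 2 θ.1‖ ≤ √d * ε := by
    intro h hh
    obtain ⟨θ, hθ⟩ := polar_approx d k (fun i => (√d)⁻¹ • h i) ε hε0 hε1 (by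
      have : ∀ i j, (⟪(√d)⁻¹ • h i, (√d)⁻¹ • h j⟫ - if i = j then (1 : ℝ) else 0) ^ 2
          = ((d : ℝ)⁻¹) ^ 2 * (⟪h i, h j⟫ - if i = j then (d : ℝ) else 0) ^ 2 := by
        intro i j
        rw [← mul_pow, inner_smul_left, inner_smul_right]
        congr 1
        simp only [conj_trivial]
        rw [← mul_assoc, ← mul_inv, ← sq, hsd2, mul_sub]
        split_ifs <;> simp [hd'.ne']
      simp_rw [this, ← Finset.mul_sum]
      calc _ ≤ ((d : ℝ)⁻¹) ^ 2 * (d * ε) ^ 2 := by gcongr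
        _ = ε ^ 2 := by field_simp)
    refine ⟨θ, ?_⟩
    refine le_of_sq_le_sq ?_ (by positivity)
    rw [PiLp.norm_sq_eq_of_L2, mul_pow]
    have : ∀ i, ‖(h - √d • WithLp.toLp 2 θ.1) i‖ ^ 2
        = √d ^ 2 * ‖(√d)⁻¹ • h i - θ.1 i‖ ^ 2 := by
      intro i
      rw [← mul_pow]
      congr 1
      nth_rw 2 [← abs_of_pos hsd]
      rw [← Real.norm_eq_abs, ← norm_smul, smul_sub, smul_smul, mul_inv_cancel₀ hsd.ne', one_smul]
      simp
    simp_rw [this, ← Finset.mul_sum]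
    gcongr
  have hhalf := gram_half d k hd ε hε0 hk
  have hne : ∃ θ : Stiefel d k, True := by
    by_contra hcon
    push Not at hcon
    have : {h : PiLp 2 (fun _ : Fin k => EuclideanSpace ℝ (Fin d)) |
        ∑ i, ∑ j, (⟪h i, h j⟫ - if i = j then (d : ℝ) else 0) ^ 2 ≤ (d * ε) ^ 2} = ∅ := by
      ext h
      simp only [Set.mem_ofPred_eq, Set.mem_empty_iff_false, iff_false]
      intro hh
      obtain ⟨θ, _⟩ := hgood h hh
      exact hcon θ
    rw [this] at hhalf
    simp at hhalf
  obtain ⟨θ₀, -⟩ := hne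
  have hKne : K.Nonempty := ⟨_, θ₀, rfl⟩
  have hmed : 1 / 2 ≤ γ {h | Metric.infDist h K ≤ √d * ε} := by
    refine hhalf.trans (measure_mono fun h hh => ?_)
    obtain ⟨θ, hθ⟩ := hgood h hh
    have hmem : √d • WithLp.toLp 2 θ.1 ∈ K := ⟨θ, rfl⟩
    have h3 := Metric.infDist_le_dist_of_mem (x := h) hmem
    rw [dist_eq_norm] at h3
    exact h3.trans hθ
  have hconc := gc_median (K := 1) one_pos (Metric.lipschitz_infDist_pt K)
    (t := √d * ε) (by positivity) hmed
  have : Nonempty {θ : Fin k → EuclideanSpace ℝ (Fin d) // Orthonormal ℝ θ} := ⟨θ₀⟩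
  let q : ℕ → {θ : Fin k → EuclideanSpace ℝ (Fin d) // Orthonormal ℝ θ} :=
    TopologicalSpace.denseSeq _
  have hq : DenseRange q := TopologicalSpace.denseRange_denseSeq _
  let p : ℕ → PiLp 2 (fun _ : Fin k => EuclideanSpace ℝ (Fin d)) → Prop :=
    fun n h => ‖h - √d • WithLp.toLp 2 (q n).1‖ < 2 * (√d * ε)
  have hp : ∀ n, MeasurableSet {h | p n h} := fun n => by
    refine measurableSet_lt ?_ measurable_const
    fun_prop
  let p' : ℕ → PiLp 2 (fun _ : Fin k => EuclideanSpace ℝ (Fin d)) → Prop :=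
    fun n h => p n h ∨ ∀ m, ¬ p m h
  have hp' : ∀ n, MeasurableSet {h | p' n h} := fun n => by
    have : {h | p' n h} = {h | p n h} ∪ ⋂ m, {h | p m h}ᶜ := by
      ext h; simp [p']
    rw [this]
    exact (hp n).union (MeasurableSet.iInter fun m => (hp m).compl)
  have hex : ∀ h, ∃ n, p' n h := by
    intro h
    by_cases hh : ∃ n, p n h
    · obtain ⟨n, hn⟩ := hh; exact ⟨n, Or.inl hn⟩
    · push Not at hh; exact ⟨0, Or.inr hh⟩
  classical
  let s : PiLp 2 (fun _ : Fin k => EuclideanSpace ℝ (Fin d)) → Stiefel d k :=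
    fun h => q (Nat.find (hex h))
  have hs : Measurable s :=
    Measurable.find (f := fun n (_ : PiLp 2 (fun _ : Fin k => EuclideanSpace ℝ (Fin d))) =>
      (q n : Stiefel d k)) (fun n => measurable_const) hp' hex
  refine ⟨s, hs, ?_⟩
  refine (measure_mono ?_).trans (hconc.trans_eq ?_)
  · intro h hh
    simp only [Set.mem_ofPred_eq] at hh ⊢
    by_contra hlt
    push Not at hlt
    have hlt' : Metric.infDist h K < 2 * (√d * ε) := by linarith
    obtain ⟨y, ⟨θ, rfl⟩, hy⟩ := (Metric.infDist_lt_iff hKne).1 hlt'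
    have hopen : IsOpen {θ : {θ : Fin k → EuclideanSpace ℝ (Fin d) // Orthonormal ℝ θ} |
        ‖h - √d • WithLp.toLp 2 θ.1‖ < 2 * (√d * ε)} := by
      refine isOpen_lt ?_ continuous_const
      fun_prop
    obtain ⟨n, hn⟩ := hq.exists_mem_open hopen ⟨θ, by
      rw [dist_eq_norm] at hy
      exact hy⟩
    have hsp : p' (Nat.find (hex h)) h := Nat.find_spec (hex h)
    rcases hsp with h1 | h1
    · exact hh h1
    · exact h1 n hn
  · congr 3
    rw [mul_pow, hsd2]; simp

end Near

noncomputable section Gam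

/-- The map `x ↦ (⟪h i, x⟫)ᵢ`. -/
def prH {d k : ℕ} (h : PiLp 2 (fun _ : Fin k => EuclideanSpace ℝ (Fin d)))
    (x : EuclideanSpace ℝ (Fin d)) : EuclideanSpace ℝ (Fin k) :=
  WithLp.toLp 2 fun i => ⟪h i, x⟫

lemma prH_continuous {d k : ℕ} :
    Continuous (fun p : (PiLp 2 (fun _ : Fin k => EuclideanSpace ℝ (Fin d))) ×
      EuclideanSpace ℝ (Fin d) => prH p.1 p.2) := by
  unfold prH
  fun_prop

lemma prH_sub {d k : ℕ} (h h' : PiLp 2 (fun _ : Fin k => EuclideanSpace ℝ (Fin d)))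
    (x : EuclideanSpace ℝ (Fin d)) : prH (h - h') x = prH h x - prH h' x := by
  ext i
  simp [prH, inner_sub_left]

lemma prH_smul {d k : ℕ} (c : ℝ) (h : PiLp 2 (fun _ : Fin k => EuclideanSpace ℝ (Fin d)))
    (x : EuclideanSpace ℝ (Fin d)) : prH (c • h) x = c • prH h x := by
  ext i
  simp [prH, inner_smul_left]

lemma prH_normsq {d k : ℕ} (h : PiLp 2 (fun _ : Fin k => EuclideanSpace ℝ (Fin d)))
    (x : EuclideanSpace ℝ (Fin d)) : ‖prH h x‖ ^ 2 = ∑ i, ⟪h i, x⟫ ^ 2 := by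
  simp [prH, EuclideanSpace.norm_sq_eq]

lemma prH_map {d k : ℕ} (x : EuclideanSpace ℝ (Fin d)) :
    (ProbabilityTheory.stdGaussian (PiLp 2 (fun _ : Fin k => EuclideanSpace ℝ (Fin d)))).map
      (fun h => prH h x)
    = (ProbabilityTheory.stdGaussian (EuclideanSpace ℝ (Fin k))).map (fun z => ‖x‖ • z) := by
  refine gauss_map_scaled _ ?_ (fun y => WithLp.toLp 2 (fun i => y i • x)) _ ?_ ?_
  · exact (prH_continuous.comp (Continuous.prodMk_left x)).measurable
  · intro h y
    simp [PiLp.inner_apply, prH, inner_smul_right]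
  · intro y
    rw [PiLp.norm_sq_eq_of_L2, EuclideanSpace.norm_sq_eq y, Finset.mul_sum]
    simp [norm_smul, mul_pow, mul_comm]

lemma jensen_sq {α : Type*} [MeasurableSpace α] (ν : Measure α) [IsProbabilityMeasure ν]
    {f : α → ℝ} (hm : AEStronglyMeasurable f ν) (hf : Integrable (fun x => f x ^ 2) ν)
    {M : ℝ} (hM : 0 ≤ M) (h : ∫ x, f x ^ 2 ∂ν ≤ M ^ 2) :
    Integrable f ν ∧ ∫ x, f x ∂ν ≤ M := by
  have h2 : MemLp f 2 ν := (memLp_two_iff_integrable_sq hm).2 hf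
  refine ⟨h2.integrable (by norm_num), ?_⟩
  have hv := variance_nonneg f ν
  rw [variance_eq_sub h2] at hv
  simp only [Pi.pow_apply] at hv
  exact le_of_sq_le_sq (by linarith) hM

variable {Ω : Type} [MeasurableSpace Ω] (P : Measure Ω) [IsProbabilityMeasure P] {d k : ℕ}
  (X : Ω → EuclideanSpace ℝ (Fin d))

lemma inner_sq_integrable (hX : Measurable X) (hXi : Integrable (fun ω => ‖X ω‖ ^ 2) P)
    (ξ : EuclideanSpace ℝ (Fin d)) : Integrable (fun ω => ⟪ξ, X ω⟫ ^ 2) P := by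
  refine (hXi.const_mul (‖ξ‖ ^ 2)).mono (by fun_prop) (ae_of_all _ fun ω => ?_)
  rw [Real.norm_eq_abs, Real.norm_eq_abs, abs_of_nonneg (sq_nonneg _), abs_of_nonneg (by positivity),
    ← mul_pow, sq_le_sq, abs_of_nonneg (by positivity : 0 ≤ ‖ξ‖ * ‖X ω‖)]
  exact abs_real_inner_le_norm _ _

lemma inner_sq_bound
    (h1 : ∀ ξ : EuclideanSpace ℝ (Fin d), ‖ξ‖ = 1 → (∫ ω, ⟪ξ, X ω⟫ ^ 2 ∂P) ≤ 1)
    (ξ : EuclideanSpace ℝ (Fin d)) : (∫ ω, ⟪ξ, X ω⟫ ^ 2 ∂P) ≤ ‖ξ‖ ^ 2 := by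
  by_cases h0 : ξ = 0
  · simp [h0]
  · have hn : 0 < ‖ξ‖ := norm_pos_iff.2 h0
    have := h1 (‖ξ‖⁻¹ • ξ) (by rw [norm_smul]; simp [hn.ne'])
    simp only [inner_smul_left, mul_pow, conj_trivial] at this
    rw [integral_const_mul, inv_pow] at this
    have h2 := mul_le_mul_of_nonneg_left this (sq_nonneg ‖ξ‖)
    rwa [mul_inv_cancel_left₀ (by positivity), mul_one] at h2

lemma prH_sq_integral (hX : Measurable X) (hXi : Integrable (fun ω => ‖X ω‖ ^ 2) P)
    (h1 : ∀ ξ : EuclideanSpace ℝ (Fin d), ‖ξ‖ = 1 → (∫ ω, ⟪ξ, X ω⟫ ^ 2 ∂P) ≤ 1)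
    (h : PiLp 2 (fun _ : Fin k => EuclideanSpace ℝ (Fin d))) :
    Integrable (fun ω => ‖prH h (X ω)‖ ^ 2) P ∧ ∫ ω, ‖prH h (X ω)‖ ^ 2 ∂P ≤ ‖h‖ ^ 2 := by
  simp only [prH_normsq]
  have hi := fun i => inner_sq_integrable P X hX hXi (h i)
  refine ⟨integrable_finsetSum _ fun i _ => hi i, ?_⟩
  rw [integral_finsetSum _ fun i _ => hi i, PiLp.norm_sq_eq_of_L2]
  exact Finset.sum_le_sum fun i _ => inner_sq_bound P X h1 _

lemma prH_meas (hX : Measurable X) (h : PiLp 2 (fun _ : Fin k => EuclideanSpace ℝ (Fin d))) :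
    Measurable fun ω => prH h (X ω) :=
  (prH_continuous.comp (Continuous.prodMk_right h)).measurable.comp hX

lemma prH_integral (hX : Measurable X) (hXi : Integrable (fun ω => ‖X ω‖ ^ 2) P)
    (h1 : ∀ ξ : EuclideanSpace ℝ (Fin d), ‖ξ‖ = 1 → (∫ ω, ⟪ξ, X ω⟫ ^ 2 ∂P) ≤ 1)
    (h : PiLp 2 (fun _ : Fin k => EuclideanSpace ℝ (Fin d))) :
    Integrable (fun ω => ‖prH h (X ω)‖) P ∧ ∫ ω, ‖prH h (X ω)‖ ∂P ≤ ‖h‖ := by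
  have := prH_sq_integral P X hX hXi h1 h
  exact jensen_sq P (prH_meas X hX h).norm.aestronglyMeasurable this.1 (norm_nonneg _) this.2

/-- The averaged test function on Gaussian frames. -/
def Gam (g : EuclideanSpace ℝ (Fin k) → ℝ)
    (h : PiLp 2 (fun _ : Fin k => EuclideanSpace ℝ (Fin d))) : ℝ :=
  ∫ ω, g ((√d)⁻¹ • prH h (X ω)) ∂P

variable {g : EuclideanSpace ℝ (Fin k) → ℝ}

lemma Gam_integrable (hX : Measurable X) (hg1 : ∀ x, |g x| ≤ 1) (hg : LipschitzWith 1 g)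
    (h : PiLp 2 (fun _ : Fin k => EuclideanSpace ℝ (Fin d))) :
    Integrable (fun ω => g ((√d)⁻¹ • prH h (X ω))) P := by
  refine Integrable.of_bound (C := 1) ?_ (ae_of_all _ fun ω => hg1 _)
  exact (hg.continuous.measurable.comp
    ((prH_meas X hX h).const_smul (√(d : ℝ))⁻¹)).aestronglyMeasurable

lemma Gam_le_one (hg1 : ∀ x, |g x| ≤ 1)
    (h : PiLp 2 (fun _ : Fin k => EuclideanSpace ℝ (Fin d))) : |Gam P X g h| ≤ 1 := by
  have := norm_integral_le_of_norm_le_const (μ := P) (C := 1)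
    (f := fun ω => g ((√d)⁻¹ • prH h (X ω))) (ae_of_all _ fun ω => hg1 _)
  simpa [Gam] using this

lemma Gam_lip (hX : Measurable X) (hXi : Integrable (fun ω => ‖X ω‖ ^ 2) P)
    (h1 : ∀ ξ : EuclideanSpace ℝ (Fin d), ‖ξ‖ = 1 → (∫ ω, ⟪ξ, X ω⟫ ^ 2 ∂P) ≤ 1)
    (hg1 : ∀ x, |g x| ≤ 1) (hg : LipschitzWith 1 g) :
    LipschitzWith (Real.toNNReal (√d)⁻¹) (Gam P X g) := by
  refine LipschitzWith.of_dist_le_mul fun h h' => ?_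
  rw [Real.dist_eq, dist_eq_norm, Real.coe_toNNReal _ (by positivity)]
  unfold Gam
  rw [← integral_sub (Gam_integrable P X hX hg1 hg h) (Gam_integrable P X hX hg1 hg h')]
  have hp := prH_integral P X hX hXi h1 (h - h')
  refine (abs_integral_le_integral_abs).trans ?_
  calc _ ≤ ∫ ω, (√d)⁻¹ * ‖prH (h - h') (X ω)‖ ∂P := by
        refine integral_mono_of_nonneg (ae_of_all _ fun _ => abs_nonneg _) (hp.1.const_mul _)
          (ae_of_all _ fun ω => ?_)
        have := hg.dist_le_mul ((√d)⁻¹ • prH h (X ω)) ((√d)⁻¹ • prH h' (X ω))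
        rw [Real.dist_eq, dist_eq_norm, ← smul_sub, ← prH_sub, norm_smul, Real.norm_eq_abs,
          abs_of_nonneg (by positivity : 0 ≤ (√(d : ℝ))⁻¹)] at this
        simpa using this
    _ ≤ _ := by
        rw [integral_const_mul]
        gcongr
        exact hp.2

lemma gauss_norm_integral (k : ℕ) :
    Integrable (fun z => ‖z‖) (ProbabilityTheory.stdGaussian (EuclideanSpace ℝ (Fin k))) ∧
    ∫ z, ‖z‖ ∂(ProbabilityTheory.stdGaussian (EuclideanSpace ℝ (Fin k))) ≤ √k := by
  refine jensen_sq _ (by fun_prop) ((gauss_norm_sq_memLp k).integrable (by norm_num))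
    (by positivity) ?_
  rw [gauss_norm_sq_integral, Real.sq_sqrt (by positivity)]

lemma sigma_le_one (hd : 0 < d) (hX : Measurable X) (hXi : Integrable (fun ω => ‖X ω‖ ^ 2) P)
    (h1 : ∀ ξ : EuclideanSpace ℝ (Fin d), ‖ξ‖ = 1 → (∫ ω, ⟪ξ, X ω⟫ ^ 2 ∂P) ≤ 1)
    {σ : ℝ} (hσ : 0 < σ) (hXσ : (∫ ω, ‖X ω‖ ^ 2 ∂P) = σ ^ 2 * d) : σ ≤ 1 := by
  have hd' : (0 : ℝ) < d := by exact_mod_cast hd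
  have e : ∫ ω, ‖X ω‖ ^ 2 ∂P ≤ d := by
    have : ∀ ω, ‖X ω‖ ^ 2 = ∑ i, ⟪EuclideanSpace.basisFun (Fin d) ℝ i, X ω⟫ ^ 2 := by
      intro ω
      rw [← (EuclideanSpace.basisFun (Fin d) ℝ).sum_sq_norm_inner_right]
      simp
    simp_rw [this]
    rw [integral_finsetSum _ fun i _ => inner_sq_integrable P X hX hXi _]
    calc _ ≤ ∑ i : Fin d, (1 : ℝ) := Finset.sum_le_sum fun i _ => h1 _ (by simp)
      _ = d := by simp
  rw [hXσ] at e
  have : σ ^ 2 ≤ 1 := by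
    by_contra hcon
    push Not at hcon
    nlinarith
  nlinarith

lemma Gam_mean (hd : 0 < d) (hX : Measurable X) (hXi : Integrable (fun ω => ‖X ω‖ ^ 2) P)
    (h1 : ∀ ξ : EuclideanSpace ℝ (Fin d), ‖ξ‖ = 1 → (∫ ω, ⟪ξ, X ω⟫ ^ 2 ∂P) ≤ 1)
    {σ L : ℝ} (hσ : 0 < σ) (hL : 0 < L)
    (hXσ : (∫ ω, ‖X ω‖ ^ 2 ∂P) = σ ^ 2 * d)
    (hXL : (∫ ω, |‖X ω‖ ^ 2 * (σ ^ 2)⁻¹ - (d : ℝ)| ∂P) ≤ L * Real.sqrt d)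
    (hg1 : ∀ x, |g x| ≤ 1) (hg : LipschitzWith 1 g) :
    |∫ h, Gam P X g h ∂(ProbabilityTheory.stdGaussian
        (PiLp 2 (fun _ : Fin k => EuclideanSpace ℝ (Fin d))))
      - ∫ z, g (σ • z) ∂(ProbabilityTheory.stdGaussian (EuclideanSpace ℝ (Fin k)))|
      ≤ L * √k / √d := by
  have hd' : (0 : ℝ) < d := by exact_mod_cast hd
  have hsd : 0 < √(d : ℝ) := Real.sqrt_pos.2 hd'
  have hsd2 : √(d : ℝ) ^ 2 = d := Real.sq_sqrt hd'.le
  set γ := ProbabilityTheory.stdGaussian (PiLp 2 (fun _ : Fin k => EuclideanSpace ℝ (Fin d)))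
  set γk := ProbabilityTheory.stdGaussian (EuclideanSpace ℝ (Fin k))
  have hσ1 : σ ≤ 1 := sigma_le_one P X hd hX hXi h1 hσ hXσ
  -- Fubini
  have hjm : Measurable (fun p : (PiLp 2 (fun _ : Fin k => EuclideanSpace ℝ (Fin d))) × Ω =>
      g ((√d)⁻¹ • prH p.1 (X p.2))) := by
    refine hg.continuous.measurable.comp (Measurable.const_smul ?_ (√(d : ℝ))⁻¹)
    exact prH_continuous.measurable.comp (measurable_fst.prodMk (hX.comp measurable_snd))
  have hji : Integrable (Function.uncurry fun (h : PiLp 2 (fun _ : Fin k =>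
      EuclideanSpace ℝ (Fin d))) ω => g ((√d)⁻¹ • prH h (X ω))) (γ.prod P) :=
    Integrable.of_bound (C := 1) hjm.aestronglyMeasurable (ae_of_all _ fun p => hg1 _)
  have hF : ∫ h, Gam P X g h ∂γ = ∫ ω, ∫ z, g (((√d)⁻¹ * ‖X ω‖) • z) ∂γk ∂P := by
    unfold Gam
    rw [integral_integral_swap hji]
    refine integral_congr_ae (ae_of_all _ fun ω => ?_)
    have hm : Measurable (fun h : PiLp 2 (fun _ : Fin k => EuclideanSpace ℝ (Fin d)) =>
      prH h (X ω)) := (prH_continuous.comp (Continuous.prodMk_left _)).measurable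
    have hgc : Continuous (fun z => g ((√d)⁻¹ • z)) := hg.continuous.comp (by fun_prop)
    have e1 := integral_map (μ := γ) hm.aemeasurable (f := fun z => g ((√d)⁻¹ • z))
      hgc.aestronglyMeasurable
    have e2 : AEMeasurable (fun z => ‖X ω‖ • z) γk := by fun_prop
    simp only
    rw [← e1, prH_map, integral_map e2 hgc.aestronglyMeasurable]
    simp only [smul_smul]
  have hgz : ∀ r : ℝ, Integrable (fun z => g (r • z)) γk := fun r =>
    Integrable.of_bound (C := 1)
      (hg.continuous.comp (by fun_prop : Continuous fun z : EuclideanSpace ℝ (Fin k) => r • z)).aestronglyMeasurable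
      (ae_of_all _ fun p => hg1 _)
  have hdiff : ∀ r : ℝ, |∫ z, g (r • z) ∂γk - ∫ z, g (σ • z) ∂γk| ≤ |r - σ| * √k := by
    intro r
    rw [← integral_sub (hgz r) (hgz σ)]
    refine (abs_integral_le_integral_abs).trans ?_
    calc _ ≤ ∫ z, |r - σ| * ‖z‖ ∂γk := by
          refine integral_mono_of_nonneg (ae_of_all _ fun _ => abs_nonneg _)
            ((gauss_norm_integral k).1.const_mul _) (ae_of_all _ fun z => ?_)
          have := hg.dist_le_mul (r • z) (σ • z)
          rw [Real.dist_eq, dist_eq_norm, ← sub_smul, norm_smul, Real.norm_eq_abs] at this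
          simpa using this
      _ ≤ _ := by
          rw [integral_const_mul]
          gcongr
          exact (gauss_norm_integral k).2
  have hIi : Integrable (fun ω => ∫ z, g (((√d)⁻¹ * ‖X ω‖) • z) ∂γk) P := by
    refine Integrable.of_bound (C := 1) ?_ (ae_of_all _ fun ω => ?_)
    · have : Measurable (fun p : Ω × EuclideanSpace ℝ (Fin k) => g (((√d)⁻¹ * ‖X p.1‖) • p.2)) := by
        refine hg.continuous.measurable.comp ?_
        fun_prop
      exact (this.stronglyMeasurable.integral_prod_right (ν := γk)).aestronglyMeasurable
    · have := norm_integral_le_of_norm_le_const (μ := γk) (C := 1)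
        (f := fun z => g (((√d)⁻¹ * ‖X ω‖) • z)) (ae_of_all _ fun ω => hg1 _)
      simpa using this
  have hc : ∫ z, g (σ • z) ∂γk = ∫ _ω, (∫ z, g (σ • z) ∂γk) ∂P := by simp
  rw [hF, hc, ← integral_sub hIi (integrable_const _)]
  refine (abs_integral_le_integral_abs).trans ?_
  have hint : Integrable (fun ω => |‖X ω‖ ^ 2 * (σ ^ 2)⁻¹ - (d : ℝ)|) P :=
    ((hXi.mul_const _).sub (integrable_const _)).abs
  calc _ ≤ ∫ ω, (√k / d) * |‖X ω‖ ^ 2 * (σ ^ 2)⁻¹ - (d : ℝ)| ∂P := by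
        refine integral_mono_of_nonneg (ae_of_all _ fun _ => abs_nonneg _)
            (hint.const_mul _) (ae_of_all _ fun ω => ?_)
        refine (hdiff _).trans ?_
        set t := (√d)⁻¹ * ‖X ω‖ with ht
        have ht0 : 0 ≤ t := by positivity
        have hXt : ‖X ω‖ ^ 2 = d * t ^ 2 := by
          rw [ht, mul_pow, inv_pow, hsd2]; field_simp
        have e1 : ‖X ω‖ ^ 2 * (σ ^ 2)⁻¹ - (d : ℝ) = d * (σ ^ 2)⁻¹ * ((t - σ) * (t + σ)) := by
          rw [hXt]; field_simp; ring
        simp only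
        rw [e1, abs_mul (d * (σ ^ 2)⁻¹), abs_mul (t - σ), abs_of_nonneg (by positivity : 0 ≤ d * (σ ^ 2)⁻¹),
          abs_of_nonneg (by positivity : 0 ≤ t + σ)]
        have e2 : √k / d * (d * (σ ^ 2)⁻¹ * (|t - σ| * (t + σ)))
          = (|t - σ| * √k) * ((σ ^ 2)⁻¹ * (t + σ)) := by field_simp
        rw [e2]
        refine le_mul_of_one_le_right (by positivity) ?_
        rw [inv_mul_eq_div, le_div_iff₀ (by positivity)]
        nlinarith
    _ = (√k / d) * ∫ ω, |‖X ω‖ ^ 2 * (σ ^ 2)⁻¹ - (d : ℝ)| ∂P := integral_const_mul _ _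
    _ ≤ (√k / d) * (L * √d) := by gcongr
    _ = _ := by
        rw [div_mul_eq_mul_div, div_eq_div_iff hd'.ne' hsd.ne']
        linear_combination (√k * L) * hsd2

lemma Gam_conc (hd : 0 < d) (hX : Measurable X) (hXi : Integrable (fun ω => ‖X ω‖ ^ 2) P)
    (h1 : ∀ ξ : EuclideanSpace ℝ (Fin d), ‖ξ‖ = 1 → (∫ ω, ⟪ξ, X ω⟫ ^ 2 ∂P) ≤ 1)
    {σ L : ℝ} (hσ : 0 < σ) (hL : 0 < L)
    (hXσ : (∫ ω, ‖X ω‖ ^ 2 ∂P) = σ ^ 2 * d)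
    (hXL : (∫ ω, |‖X ω‖ ^ 2 * (σ ^ 2)⁻¹ - (d : ℝ)| ∂P) ≤ L * Real.sqrt d)
    (hg1 : ∀ x, |g x| ≤ 1) (hg : LipschitzWith 1 g) {ε : ℝ} (hε : 0 < ε)
    (hLε : L * √k ≤ ε * √d) :
    (ProbabilityTheory.stdGaussian (PiLp 2 (fun _ : Fin k => EuclideanSpace ℝ (Fin d))))
      {h | 2 * ε ≤ |Gam P X g h
        - ∫ z, g (σ • z) ∂(ProbabilityTheory.stdGaussian (EuclideanSpace ℝ (Fin k)))|}
      ≤ ENNReal.ofReal (6 * exp (-(d * ε ^ 2 / 8))) := by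
  have hd' : (0 : ℝ) < d := by exact_mod_cast hd
  have hsd : 0 < √(d : ℝ) := Real.sqrt_pos.2 hd'
  have hsd2 : √(d : ℝ) ^ 2 = d := Real.sq_sqrt hd'.le
  set γ := ProbabilityTheory.stdGaussian (PiLp 2 (fun _ : Fin k => EuclideanSpace ℝ (Fin d)))
  set m := ∫ z, g (σ • z) ∂(ProbabilityTheory.stdGaussian (EuclideanSpace ℝ (Fin k)))
  have hmean := (Gam_mean (k := k) P X hd hX hXi h1 hσ hL hXσ hXL hg1 hg).trans
    ((div_le_iff₀ hsd).2 hLε)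
  have hlip := Gam_lip P X hX hXi h1 hg1 hg
  have hK0 : 0 < Real.toNNReal (√(d : ℝ))⁻¹ := Real.toNNReal_pos.2 (by positivity)
  have c1 := gc_mean hK0 hlip hε.le (Gam_le_one P X hg1)
  have c2 := gc_mean hK0 hlip.neg hε.le (fun h => by simpa using Gam_le_one P X hg1 h)
  rw [Real.coe_toNNReal _ (by positivity), inv_pow, hsd2] at c1 c2
  have hex : ε ^ 2 / (8 * (d : ℝ)⁻¹) = d * ε ^ 2 / 8 := by field_simp
  rw [hex] at c1 c2
  refine (measure_mono ?_).trans ((measure_union_le _ _).trans ((add_le_add c1 c2).trans_eq ?_))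
  · intro h hh
    simp only [Set.mem_ofPred_eq, Set.mem_union, Pi.neg_apply, integral_neg] at hh ⊢
    have h2 := abs_le.1 hmean
    rcases le_abs.1 hh with h3 | h3
    · left; linarith [h2.2]
    · right; linarith [h2.1]
  · rw [← ENNReal.ofReal_add (by positivity) (by positivity)]
    congr 1; ring

end Gam

section Core

lemma dBL_tail {k : ℕ} {α : Type*} [MeasurableSpace α] (ν : Measure α) [IsProbabilityMeasure ν]
    {Y : α → EuclideanSpace ℝ (Fin k)} (hY : Measurable Y)
    (hi : Integrable (fun x => ‖Y x‖ ^ 2) ν) {M : ℝ} (hM : ∫ x, ‖Y x‖ ^ 2 ∂ν ≤ M)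
    {f g : EuclideanSpace ℝ (Fin k) → ℝ} (hf1 : ∀ x, |f x| ≤ 1) (hf : LipschitzWith 1 f)
    (hg1 : ∀ x, |g x| ≤ 1) (hg : LipschitzWith 1 g) {R η : ℝ} (hR : 0 < R) (hη : 0 ≤ η)
    (hfg : ∀ x, ‖x‖ ≤ R → |f x - g x| ≤ η) :
    |∫ x, f (Y x) ∂ν - ∫ x, g (Y x) ∂ν| ≤ η + 2 * (M / R ^ 2) := by
  have hfi : ∀ {φ : EuclideanSpace ℝ (Fin k) → ℝ}, (∀ x, |φ x| ≤ 1) → LipschitzWith 1 φ →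
      Integrable (fun x => φ (Y x)) ν := fun h1 h2 =>
    Integrable.of_bound (C := 1) (h2.continuous.measurable.comp hY).aestronglyMeasurable
      (ae_of_all _ fun x => h1 _)
  rw [← integral_sub (hfi hf1 hf) (hfi hg1 hg)]
  refine (abs_integral_le_integral_abs).trans ?_
  have hint : Integrable (fun x => η + 2 / R ^ 2 * ‖Y x‖ ^ 2) ν :=
    (integrable_const _).add (hi.const_mul _)
  calc _ ≤ ∫ x, (η + 2 / R ^ 2 * ‖Y x‖ ^ 2) ∂ν := by
        refine integral_mono_of_nonneg (ae_of_all _ fun _ => abs_nonneg _) hint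
          (ae_of_all _ fun x => ?_)
        simp only
        by_cases hx : ‖Y x‖ ≤ R
        · have := hfg _ hx
          have h2 : 0 ≤ 2 / R ^ 2 * ‖Y x‖ ^ 2 := by positivity
          linarith
        · push Not at hx
          have h1 := abs_le.1 (hf1 (Y x))
          have h2 := abs_le.1 (hg1 (Y x))
          have h3 : |f (Y x) - g (Y x)| ≤ 2 := abs_le.2 ⟨by linarith, by linarith⟩
          have h4 : 2 ≤ 2 / R ^ 2 * ‖Y x‖ ^ 2 := by
            rw [div_mul_eq_mul_div, le_div_iff₀ (by positivity)]
            nlinarith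
          linarith
    _ = η + 2 / R ^ 2 * ∫ x, ‖Y x‖ ^ 2 ∂ν := by
        rw [integral_add (integrable_const _) (hi.const_mul _), integral_const_mul]
        simp
    _ ≤ _ := by
        have : 2 / R ^ 2 * ∫ x, ‖Y x‖ ^ 2 ∂ν ≤ 2 / R ^ 2 * M := by gcongr
        have e : 2 / R ^ 2 * M = 2 * (M / R ^ 2) := by ring
        linarith

lemma core {Ω : Type} [MeasurableSpace Ω] (P : Measure Ω) [IsProbabilityMeasure P] {d k : ℕ}
    (X : Ω → EuclideanSpace ℝ (Fin d)) (hk : 0 < k) (hkd : k ≤ d)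
    (hX : Measurable X) (hXi : Integrable (fun ω => ‖X ω‖ ^ 2) P)
    (h1 : ∀ ξ : EuclideanSpace ℝ (Fin d), ‖ξ‖ = 1 → (∫ ω, ⟪ξ, X ω⟫ ^ 2 ∂P) ≤ 1)
    {σ L : ℝ} (hσ : 0 < σ) (hL : 0 < L)
    (hXσ : (∫ ω, ‖X ω‖ ^ 2 ∂P) = σ ^ 2 * d)
    (hXL : (∫ ω, |‖X ω‖ ^ 2 * (σ ^ 2)⁻¹ - (d : ℝ)| ∂P) ≤ L * Real.sqrt d)
    {ε : ℝ} (hε0 : 0 < ε) (hε1 : ε < 1) (hkε : 160 * (k : ℝ) ^ 2 ≤ d * ε ^ 2)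
    (hLε : L * √k ≤ ε * √d) (μ : Measure (Stiefel d k)) (hμ : IsHaarStiefel μ) :
    ∃ T : Set (Stiefel d k), MeasurableSet T ∧
      1 - ENNReal.ofReal (6 * (1 + (2 / ε + 1) ^ ((1 + 2 * (√k / ε) / ε) ^ k))
        * exp (-(d * ε ^ 2 / 8))) ≤ μ T ∧
      ∀ θ ∈ T, dBL (P.map fun ω => stiefelProj θ (X ω))
        ((_root_.stdGaussian k).map fun z => σ • z) ≤ 14 * ε := by
  have hd : 0 < d := hk.trans_le hkd
  have hd' : (0 : ℝ) < d := by exact_mod_cast hd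
  have hk' : (0 : ℝ) < k := by exact_mod_cast hk
  have hsd : 0 < √(d : ℝ) := Real.sqrt_pos.2 hd'
  have hsk : 0 < √(k : ℝ) := Real.sqrt_pos.2 hk'
  have hσ1 := sigma_le_one P X hd hX hXi h1 hσ hXσ
  have := hμ.1
  set γ := ProbabilityTheory.stdGaussian (PiLp 2 (fun _ : Fin k => EuclideanSpace ℝ (Fin d)))
    with hγ
  set γk := ProbabilityTheory.stdGaussian (EuclideanSpace ℝ (Fin k)) with hγk
  obtain ⟨𝓖, h𝓖, hcard, hnet⟩ := net_functions k (R := √k / ε) (η := ε) (by positivity) hε0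
  set N : ℝ := (2 / ε + 1) ^ ((1 + 2 * (√k / ε) / ε) ^ k) with hN
  obtain ⟨s, hs, hsγ⟩ := gauss_near d k hd ε hε0 hε1 hkε
  let ι : Stiefel d k → PiLp 2 (fun _ : Fin k => EuclideanSpace ℝ (Fin d)) :=
    fun θ => WithLp.toLp 2 θ.1
  have hι : Measurable ι := (WithLp.measurable_toLp 2 _).comp measurable_subtype_coe
  let F : (EuclideanSpace ℝ (Fin k) → ℝ) → Stiefel d k → ℝ := fun g θ => Gam P X g (√d • ι θ)
  let m : (EuclideanSpace ℝ (Fin k) → ℝ) → ℝ := fun g => ∫ z, g (σ • z) ∂γk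
  have hF : ∀ g ∈ 𝓖, Measurable (F g) := fun g hg =>
    (Gam_lip P X hX hXi h1 (h𝓖 g hg).1 (h𝓖 g hg).2).continuous.measurable.comp (hι.const_smul (√(d : ℝ)))
  let B : Set (Stiefel d k) := ⋃ g ∈ 𝓖, {θ | 4 * ε < |F g θ - m g|}
  have hB : MeasurableSet B := by
    refine Finset.measurableSet_biUnion _ fun g hg => ?_
    exact measurableSet_lt measurable_const ((hF g hg).sub_const _).abs
  have hμB : μ B ≤ ENNReal.ofReal (6 * (1 + N) * exp (-(d * ε ^ 2 / 8))) := by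
    refine haar_transfer hkd μ hμ γ s hs hB _ fun U => ?_
    let UH : PiLp 2 (fun _ : Fin k => EuclideanSpace ℝ (Fin d)) ≃ₗᵢ[ℝ]
      PiLp 2 (fun _ : Fin k => EuclideanSpace ℝ (Fin d)) :=
      LinearIsometryEquiv.piLpCongrRight 2 (fun _ => U)
    have hUι : ∀ θ, ι (stiefelRotate U θ) = UH (ι θ) := by
      intro θ
      ext i
      simp [ι, UH, stiefelRotate]
    have hinv : γ.map UH = γ := by
      rw [hγ]; exact stdGaussian_map UH
    have hsub : {a | stiefelRotate U (s a) ∈ B} ⊆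
        {h | ¬ ‖h - √d • WithLp.toLp 2 (s h).1‖ < 2 * (√d * ε)} ∪
        ⋃ g ∈ 𝓖, UH ⁻¹' {h | 2 * ε ≤ |Gam P X g h - m g|} := by
      intro h hh
      by_cases hb : ‖h - √d • WithLp.toLp 2 (s h).1‖ < 2 * (√d * ε)
      · right
        simp only [B, Set.mem_ofPred_eq, Set.mem_iUnion, exists_prop] at hh
        obtain ⟨g, hg, hlt⟩ := hh
        simp only [Set.mem_iUnion, exists_prop]
        refine ⟨g, hg, ?_⟩
        simp only [Set.mem_preimage, Set.mem_ofPred_eq]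
        have hl := (Gam_lip P X hX hXi h1 (h𝓖 g hg).1 (h𝓖 g hg).2).dist_le_mul (UH h)
          (√d • ι (stiefelRotate U (s h)))
        rw [hUι, ← map_smul, UH.dist_map, Real.dist_eq, dist_eq_norm,
          Real.coe_toNNReal _ (by positivity)] at hl
        have hl2 : |Gam P X g (UH h) - Gam P X g (UH (√d • ι (s h)))| ≤ 2 * ε := by
          refine hl.trans ?_
          calc _ ≤ (√(d : ℝ))⁻¹ * (2 * (√d * ε)) := by gcongr
            _ = 2 * ε := by field_simp
        have hlt' : 4 * ε < |Gam P X g (UH (√d • ι (s h))) - m g| := by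
          have := hlt
          simp only [F, hUι] at this
          rwa [map_smul]
        have htri := abs_sub_le (Gam P X g (UH (√d • ι (s h)))) (Gam P X g (UH h)) (m g)
        rw [abs_sub_comm (Gam P X g (UH (√d • ι (s h)))) (Gam P X g (UH h))] at htri
        linarith
      · left; exact hb
    refine (measure_mono hsub).trans ((measure_union_le _ _).trans ?_)
    have hun : γ (⋃ g ∈ 𝓖, UH ⁻¹' {h | 2 * ε ≤ |Gam P X g h - m g|})
        ≤ ENNReal.ofReal (N * (6 * exp (-(d * ε ^ 2 / 8)))) := by
      refine (measure_biUnion_finset_le _ _).trans ?_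
      calc _ ≤ ∑ g ∈ 𝓖, ENNReal.ofReal (6 * exp (-(d * ε ^ 2 / 8))) := by
            refine Finset.sum_le_sum fun g hg => ?_
            have hme : MeasurableSet {h | 2 * ε ≤ |Gam P X g h - m g|} :=
              measurableSet_le measurable_const
                ((Gam_lip P X hX hXi h1 (h𝓖 g hg).1
                  (h𝓖 g hg).2).continuous.measurable.sub_const _).abs
            rw [← Measure.map_apply UH.continuous.measurable hme, hinv]
            exact Gam_conc P X hd hX hXi h1 hσ hL hXσ hXL (h𝓖 g hg).1 (h𝓖 g hg).2 hε0 hLε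
        _ = ENNReal.ofReal (𝓖.card * (6 * exp (-(d * ε ^ 2 / 8)))) := by
            rw [Finset.sum_const, nsmul_eq_mul, ENNReal.ofReal_mul (by positivity)]
            simp
        _ ≤ _ := by
            apply ENNReal.ofReal_le_ofReal
            gcongr
    refine (add_le_add hsγ hun).trans_eq ?_
    rw [← ENNReal.ofReal_add (by positivity) (by positivity)]
    congr 1; ring
  refine ⟨Bᶜ, hB.compl, ?_, ?_⟩
  · rw [prob_compl_eq_one_sub hB]
    exact tsub_le_tsub_left hμB 1
  · intro θ hθ
    have hθ' : ∀ g ∈ 𝓖, |F g θ - m g| ≤ 4 * ε := by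
      intro g hg
      by_contra hcon
      push Not at hcon
      exact hθ (by
        simp only [B, Set.mem_iUnion, exists_prop]
        exact ⟨g, hg, hcon⟩)
    have hFe : ∀ g, F g θ = ∫ ω, g (prH (ι θ) (X ω)) ∂P := by
      intro g
      simp only [F, Gam, prH_smul]
      simp [smul_smul, hsd.ne']
    have hιn : ‖ι θ‖ ^ 2 = k := by
      rw [PiLp.norm_sq_eq_of_L2]
      simp [ι, θ.2.1]
    have hsm : Measurable (fun z : EuclideanSpace ℝ (Fin k) => σ • z) := by fun_prop
    have hpm : Measurable fun ω => stiefelProj θ (X ω) := prH_meas X hX (ι θ)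
    have : Nonempty {f : EuclideanSpace ℝ (Fin k) → ℝ // (∀ x, |f x| ≤ 1) ∧ LipschitzWith 1 f} :=
      ⟨⟨fun _ => 0, by simp, LipschitzWith.const' 0⟩⟩
    unfold dBL
    refine ciSup_le fun f => ?_
    obtain ⟨f, hf1, hf⟩ := f
    simp only
    rw [stdGaussian_eq, integral_map hpm.aemeasurable hf.continuous.aestronglyMeasurable,
      integral_map hsm.aemeasurable hf.continuous.aestronglyMeasurable]
    obtain ⟨g, hg, hfg⟩ := hnet f hf1 hf
    have hRpos : 0 < √(k : ℝ) / ε := by positivity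
    have hRk : (k : ℝ) / (√(k : ℝ) / ε) ^ 2 = ε ^ 2 := by
      rw [div_pow, Real.sq_sqrt hk'.le]; field_simp
    have hq := prH_sq_integral P X hX hXi h1 (ι θ)
    have t1 := dBL_tail P (prH_meas X hX (ι θ)) hq.1 (hq.2.trans_eq hιn) hf1 hf (h𝓖 g hg).1
      (h𝓖 g hg).2 hRpos (by positivity) hfg
    have t2 := dBL_tail γk (Y := fun z => σ • z) hsm (M := k) (by
        simp only [norm_smul, mul_pow]
        exact ((gauss_norm_sq_memLp k).integrable (by norm_num)).const_mul _) (by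
        simp only [norm_smul, mul_pow, integral_const_mul]
        rw [hγk, gauss_norm_sq_integral, Real.norm_eq_abs, sq_abs]
        have : σ ^ 2 ≤ 1 := by nlinarith
        nlinarith) hf1 hf (h𝓖 g hg).1
      (h𝓖 g hg).2 hRpos (by positivity) hfg
    rw [hRk] at t1 t2
    have t3 := hθ' g hg
    rw [hFe] at t3
    have hε2 : ε ^ 2 ≤ ε := by nlinarith
    change |∫ ω, f (prH (ι θ) (X ω)) ∂P - ∫ z, f (σ • z) ∂γk| ≤ 14 * ε
    simp only [m] at t3
    have a1 := abs_le.1 t1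
    have a2 := abs_le.1 t2
    have a3 := abs_le.1 t3
    exact abs_le.2 ⟨by linarith [a1.1, a2.2, a3.1], by linarith [a1.2, a2.1, a3.2]⟩

end Core

section Analytic

lemma dBL_le_two {k : ℕ} (μ ν : Measure (EuclideanSpace ℝ (Fin k))) [IsProbabilityMeasure μ]
    [IsProbabilityMeasure ν] : dBL μ ν ≤ 2 := by
  have : Nonempty {f : EuclideanSpace ℝ (Fin k) → ℝ // (∀ x, |f x| ≤ 1) ∧ LipschitzWith 1 f} :=
    ⟨⟨fun _ => 0, by simp, LipschitzWith.const' 0⟩⟩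
  unfold dBL
  refine ciSup_le fun f => ?_
  obtain ⟨f, hf1, hf⟩ := f
  have h : ∀ ρ : Measure (EuclideanSpace ℝ (Fin k)), IsProbabilityMeasure ρ →
      |∫ x, f x ∂ρ| ≤ 1 := by
    intro ρ hρ
    have := norm_integral_le_of_norm_le_const (μ := ρ) (C := 1) (f := f) (ae_of_all _ hf1)
    simpa using this
  have h1 := abs_le.1 (h μ inferInstance)
  have h2 := abs_le.1 (h ν inferInstance)
  exact abs_le.2 ⟨by simp only; linarith, by simp only; linarith⟩

set_option maxHeartbeats 2000000 in
lemma analytic_bounds {b c L x y δ ε : ℝ} {d k : ℕ} (hb : b < 2) (hc : 0 < c)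
    (hcb : 8 * c + b / 2 = 1) (hk : 0 < k) (hd : 0 < d) (hx : x = Real.log d) (hy : y = Real.log x)
    (hδ0 : 0 < δ) (hδb : δ ≤ b) (hkx : (k : ℝ) = δ * x / y)
    (hε : ε = 2 * exp (-(c * y / δ))) (hL : 0 < L) (hy4 : 4 / c ≤ y) (hx0 : 1 < x)
    (hx1 : 160 * x ^ 2 ≤ 4 * exp (3 / 4 * x)) (hx2 : L ^ 2 * x ≤ 4 * exp (3 / 4 * x)) :
    0 < ε ∧ ε < 1 ∧ 160 * (k : ℝ) ^ 2 ≤ d * ε ^ 2 ∧ L * √k ≤ ε * √d ∧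
    6 * (1 + (2 / ε + 1) ^ ((1 + 2 * (√k / ε) / ε) ^ k)) * exp (-(d * ε ^ 2 / 8))
      ≤ 12 * exp (-(1 / 16 * d * ε ^ 2)) := by
  have hd' : (0 : ℝ) < d := by exact_mod_cast hd
  have hk' : (1 : ℝ) ≤ k := by exact_mod_cast hk
  have hb0 : 0 < b := hδ0.trans_le hδb
  have hc8 : c ≤ 1 / 8 := by linarith
  have hy32 : 32 ≤ y := by
    refine le_trans ?_ hy4
    rw [le_div_iff₀ hc]; linarith
  have hyc : 4 ≤ c * y := by rw [div_le_iff₀ hc] at hy4; linarith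
  have hexp : exp x = d := by rw [hx, Real.exp_log hd']
  have hexpy : exp y = x := by rw [hy, Real.exp_log (by linarith)]
  have hε0 : 0 < ε := by rw [hε]; positivity
  have hky : k * y = δ * x := by rw [hkx]; field_simp
  have hyδ : y / δ = x / k := by
    rw [div_eq_div_iff hδ0.ne' (by linarith)]; linarith
  have hcyδ : c * y / δ = c * (x / k) := by rw [mul_div_assoc, hyδ]
  have hl2 : Real.log 2 < 1 := by linarith [Real.log_two_lt_d9]
  have hl2' : 0 < Real.log 2 := Real.log_pos (by norm_num)
  -- size of log ε
  have hlog : Real.log ε = Real.log 2 - c * y / δ := by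
    rw [hε, Real.log_mul (by norm_num) (by positivity), Real.log_exp]; ring
  have h2cy : 2 ≤ c * y / δ := by
    rw [le_div_iff₀ hδ0]; nlinarith
  have hε1 : ε < 1 := by
    rw [← Real.log_neg_iff hε0, hlog]; linarith
  have hxk : x / k ≤ x := div_le_self (by linarith) hk'
  have hlogx : - Real.log ε ≤ c * x := by
    rw [hlog, hcyδ]
    nlinarith
  have hlogk : k * (- Real.log ε) ≤ c * x := by
    rw [hlog, hcyδ]
    have : (k : ℝ) * (c * (x / k)) = c * x := by field_simp
    nlinarith
  have hkx' : (k : ℝ) ≤ x := by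
    by_contra hcon
    push Not at hcon
    nlinarith
  -- dε² is large
  have hdε : 4 * exp (3 / 4 * x) ≤ d * ε ^ 2 := by
    rw [hε, ← hexp, mul_pow, ← Real.exp_nat_mul]
    have : exp (3 / 4 * x) ≤ exp (x + ((2 : ℕ) : ℝ) * (-(c * y / δ))) := by
      apply Real.exp_le_exp.2
      rw [hcyδ]
      push_cast
      have : c * (x / k) ≤ 1 / 8 * x := by
        apply mul_le_mul hc8 hxk (by positivity) (by norm_num)
      linarith
    rw [Real.exp_add] at this
    linarith
  refine ⟨hε0, hε1, ?_, ?_, ?_⟩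
  · have : (k : ℝ) ^ 2 ≤ x ^ 2 := by gcongr
    linarith
  · refine le_of_sq_le_sq ?_ (by positivity)
    rw [mul_pow, mul_pow, Real.sq_sqrt (by positivity), Real.sq_sqrt (by positivity)]
    have : L ^ 2 * k ≤ L ^ 2 * x := by gcongr
    linarith
  · set M : ℝ := (1 + 2 * (√k / ε) / ε) ^ k with hM
    have hMpos : 0 < M := by positivity
    have hsk : 1 ≤ √(k : ℝ) := Real.one_le_sqrt.2 hk'
    have hbase : 1 + 2 * (√k / ε) / ε ≤ 3 * √k * (ε ^ 2)⁻¹ := by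
      have h1 : 1 ≤ √k * (ε ^ 2)⁻¹ := by
        have : 1 ≤ (ε ^ 2)⁻¹ := (one_le_inv₀ (by positivity)).2 (by nlinarith)
        nlinarith
      have h2 : 2 * (√k / ε) / ε = 2 * (√k * (ε ^ 2)⁻¹) := by field_simp
      rw [h2]; linarith
    have hlogM : Real.log M ≤ (3 * c + b / 2) * x := by
      rw [hM, Real.log_pow]
      have h1 : Real.log (1 + 2 * (√k / ε) / ε)
          ≤ Real.log 3 + 1 / 2 * Real.log k + 2 * (- Real.log ε) := by
        refine (Real.log_le_log (by positivity) hbase).trans_eq ?_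
        rw [Real.log_mul (by positivity) (by positivity), Real.log_mul (by norm_num) (by positivity),
          Real.log_inv, Real.log_pow, Real.log_sqrt (by positivity)]
        push_cast; ring
      have h3 : Real.log 3 ≤ 2 := by
        have := Real.log_le_sub_one_of_pos (show (0 : ℝ) < 3 by norm_num)
        linarith
      have h4 : Real.log k ≤ y := by
        rw [hy]; exact Real.log_le_log (by linarith) hkx'
      have h5 : (k : ℝ) * 2 ≤ c * x := by
        have e1 : k * y * 2 ≤ 4 * x := by rw [hky]; nlinarith
        have e2 : 4 * x ≤ c * y * x := by nlinarith
        by_contra hcon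
        push Not at hcon
        nlinarith
      have h6 : (k : ℝ) * (1 / 2 * Real.log k) ≤ b / 2 * x := by
        have : (k : ℝ) * (1 / 2 * Real.log k) ≤ k * (1 / 2 * y) := by gcongr
        nlinarith
      calc (k : ℝ) * Real.log (1 + 2 * (√k / ε) / ε)
          ≤ k * (Real.log 3 + 1 / 2 * Real.log k + 2 * (- Real.log ε)) := by gcongr
        _ = k * Real.log 3 + k * (1 / 2 * Real.log k) + 2 * (k * (- Real.log ε)) := by ring
        _ ≤ _ := by nlinarith
    have h32 : M * (2 / ε) ≤ d * ε ^ 2 / 16 := by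
      have h0 : 32 * M ≤ d * ε ^ 3 := by
        rw [← Real.log_le_log_iff (by positivity) (by positivity),
          Real.log_mul (by norm_num) (by positivity), Real.log_mul (by positivity) (by positivity),
          Real.log_pow ε 3, ← hx]
        have e1 : Real.log 32 ≤ 5 := by
          have : (32 : ℝ) = 2 ^ 5 := by norm_num
          rw [this, Real.log_pow]; push_cast; linarith
        have e2 : 5 ≤ 2 * c * x := by
          have : y + 1 ≤ x := by rw [← hexpy]; exact Real.add_one_le_exp y
          nlinarith
        push_cast
        have e3 : 8 * c * x + b / 2 * x = x := by linear_combination x * hcb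
        linarith
      rw [mul_div_assoc', div_le_div_iff₀ hε0 (by norm_num)]
      nlinarith
    have hN : (2 / ε + 1) ^ M ≤ exp (d * ε ^ 2 / 16) := by
      rw [Real.rpow_def_of_pos (by positivity)]
      apply Real.exp_le_exp.2
      have : Real.log (2 / ε + 1) ≤ 2 / ε := by
        have := Real.log_le_sub_one_of_pos (show 0 < 2 / ε + 1 by positivity)
        linarith
      calc _ ≤ 2 / ε * M := by gcongr
        _ ≤ _ := by linarith
    have hone : 1 ≤ exp (d * ε ^ 2 / 16) := Real.one_le_exp (by positivity)
    calc 6 * (1 + (2 / ε + 1) ^ M) * exp (-(d * ε ^ 2 / 8))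
        ≤ 6 * (exp (d * ε ^ 2 / 16) + exp (d * ε ^ 2 / 16)) * exp (-(d * ε ^ 2 / 8)) := by gcongr
      _ = 12 * (exp (d * ε ^ 2 / 16) * exp (-(d * ε ^ 2 / 8))) := by ring
      _ = _ := by rw [← Real.exp_add]; congr 2; ring

lemma exists_threshold (c L : ℝ) : ∃ X0 : ℝ, 1 < X0 ∧ ∀ x, X0 ≤ x →
    4 / c ≤ Real.log x ∧ 160 * x ^ 2 ≤ 4 * exp (3 / 4 * x) ∧ L ^ 2 * x ≤ 4 * exp (3 / 4 * x) := by
  have h1 : ∀ᶠ x : ℝ in Filter.atTop, 4 / c ≤ Real.log x :=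
    Real.tendsto_log_atTop.eventually_ge_atTop _
  have hlim : ∀ n : ℕ, ∀ A : ℝ, ∀ᶠ x : ℝ in Filter.atTop, A * x ^ n ≤ 4 * exp (3 / 4 * x) := by
    intro n A
    have := (isLittleO_pow_exp_pos_mul_atTop n (show (0 : ℝ) < 3 / 4 by norm_num)).const_mul_left A
    filter_upwards [this.bound (show (0 : ℝ) < 4 by norm_num)] with x hx
    refine (le_abs_self _).trans (hx.trans_eq ?_)
    rw [Real.norm_eq_abs, abs_of_pos (exp_pos _)]
  have h3 := hlim 1 (L ^ 2)
  simp only [pow_one] at h3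
  obtain ⟨X0, hX0⟩ := Filter.eventually_atTop.1 (h1.and ((hlim 2 160).and h3))
  exact ⟨max X0 2, lt_max_of_lt_right (by norm_num), fun x hx => hX0 x ((le_max_left _ _).trans hx)⟩

end Analytic

/-- **Corollary (summary).** If `X ∈ ℝ^d` has `𝔼|X|² = σ²d`, `𝔼||X|²σ⁻² - d| ≤ L√d`, and
`sup_ξ 𝔼⟨ξ,X⟩² ≤ 1`, and `k = δ log d / log log d` with `a ≤ δ ≤ b < 2`, then, with
`ε = 2 exp(-c log log d / δ)`, there is a set `T` of Haar measure at least
`1 - C exp(-c' d ε²)` on which `d_BL(X_θ, σZ) ≤ C' ε`. -/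
theorem projections_corollary (a b L : ℝ) (ha : 0 < a) (hb : b < 2) (hL : 0 < L) :
    ∃ c c' C C' : ℝ, 0 < c ∧ 0 < c' ∧ 0 < C ∧ 0 < C' ∧
      ∀ {Ω : Type} [MeasurableSpace Ω] (P : Measure Ω), ∀ _ : IsProbabilityMeasure P,
      ∀ (d k : ℕ), 0 < k → k ≤ d →
      ∀ (X : Ω → EuclideanSpace ℝ (Fin d)), Measurable X →
      ∀ σ : ℝ, 0 < σ →
      Integrable (fun ω => ‖X ω‖ ^ 2) P →
      (∫ ω, ‖X ω‖ ^ 2 ∂P) = σ ^ 2 * d →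
      (∫ ω, |‖X ω‖ ^ 2 * (σ ^ 2)⁻¹ - (d : ℝ)| ∂P) ≤ L * Real.sqrt d →
      (∀ ξ : EuclideanSpace ℝ (Fin d), ‖ξ‖ = 1 → (∫ ω, ⟪ξ, X ω⟫ ^ 2 ∂P) ≤ 1) →
      ∀ δ : ℝ, a ≤ δ → δ ≤ b →
        (k : ℝ) = δ * Real.log d / Real.log (Real.log d) →
      ∀ (μ : Measure (Stiefel d k)), IsHaarStiefel μ →
      ∀ ε : ℝ, ε = 2 * Real.exp (-(c * Real.log (Real.log d) / δ)) →
        ∃ T : Set (Stiefel d k), MeasurableSet T ∧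
          1 - ENNReal.ofReal (C * Real.exp (-(c' * d * ε ^ 2))) ≤ μ T ∧
          ∀ θ ∈ T,
            dBL (P.map fun ω => stiefelProj θ (X ω))
              ((stdGaussian k).map fun z => σ • z) ≤ C' * ε := by
  by_cases hab : a ≤ b
  swap
  · refine ⟨1, 1, 1, 1, one_pos, one_pos, one_pos, one_pos, ?_⟩
    intro Ω _ P _ d k _ _ X _ σ _ _ _ _ _ δ h1 h2
    exact absurd (h1.trans h2) hab
  have hc : 0 < (1 - b / 2) / 8 := by linarith
  set c := (1 - b / 2) / 8 with hcdef
  obtain ⟨X0, hX0, hthr⟩ := exists_threshold c L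
  refine ⟨c, 1 / 16, 12, max 14 (exp (c * Real.log X0 / a)), hc, by norm_num, by norm_num,
    lt_max_of_lt_left (by norm_num), ?_⟩
  intro Ω _ P hP d k hk hkd X hX σ hσ hXi hXσ hXL h1 δ hδa hδb hkx μ hμ ε hε
  have hδ0 : 0 < δ := ha.trans_le hδa
  have hd : 0 < d := hk.trans_le hkd
  have hk' : (0 : ℝ) < k := by exact_mod_cast hk
  have hx0 : 0 < Real.log d := by
    have h0 : 0 ≤ Real.log d := Real.log_natCast_nonneg d
    rcases h0.lt_or_eq with h | h
    · exact h
    · rw [← h] at hkx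
      simp at hkx
      omega
  have hy0 : 0 < Real.log (Real.log d) := by
    by_contra hcon
    push Not at hcon
    have : δ * Real.log d / Real.log (Real.log d) ≤ 0 :=
      div_nonpos_of_nonneg_of_nonpos (by positivity) hcon
    linarith
  have hx1 : 1 < Real.log d := by
    by_contra hcon
    push Not at hcon
    linarith [Real.log_nonpos hx0.le hcon]
  have hεpos : 0 < ε := by rw [hε]; positivity
  rcases le_or_gt X0 (Real.log d) with hlarge | hsmall
  · obtain ⟨t1, t2, t3⟩ := hthr _ hlarge
    obtain ⟨e0, e1, e2, e3, e4⟩ := analytic_bounds hb hc (by rw [hcdef]; ring) hk hd rfl rfl hδ0 hδb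
      hkx hε hL t1 hx1 t2 t3
    obtain ⟨T, hT, hμT, hdT⟩ := core P X hk hkd hX hXi h1 hσ hL hXσ hXL e0 e1 e2 e3 μ hμ
    refine ⟨T, hT, le_trans (tsub_le_tsub_left (ENNReal.ofReal_le_ofReal e4) 1) hμT, ?_⟩
    intro θ hθ
    refine (hdT θ hθ).trans ?_
    gcongr
    exact le_max_left _ _
  · have := hμ.1
    refine ⟨Set.univ, MeasurableSet.univ, by simp, ?_⟩
    intro θ _
    have hp1 : IsProbabilityMeasure (P.map fun ω => stiefelProj θ (X ω)) := by
      refine Measure.isProbabilityMeasure_map (Measurable.aemeasurable ?_)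
      exact prH_meas X hX (WithLp.toLp 2 θ.1)
    have hp2 : IsProbabilityMeasure ((_root_.stdGaussian k).map fun z => σ • z) := by
      rw [stdGaussian_eq]
      exact Measure.isProbabilityMeasure_map (by fun_prop)
    refine (dBL_le_two _ _).trans ?_
    have hle : c * Real.log (Real.log d) / δ ≤ c * Real.log X0 / a := by
      have hX0p := Real.log_pos hX0
      gcongr
    have h2 : 2 = exp (c * Real.log (Real.log d) / δ) * ε := by
      rw [hε, mul_left_comm, ← Real.exp_add]; simp
    calc (2 : ℝ) = exp (c * Real.log (Real.log d) / δ) * ε := h2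
      _ ≤ exp (c * Real.log X0 / a) * ε := by gcongr
      _ ≤ _ := by gcongr; exact le_max_right _ _

end
end

section
/- Let k ≥ 1, let S ⊂ ℝ^k be a nonempty finite set with N points, let μ_S be the uniform probability measure on S, and let γ_k be the standard Gaussian measure on ℝ^k. Define f : ℝ^k → ℝ by f(x) := max(0, 1 − dist(x,S)), where dist(x,S) is the Euclidean distance from x to S. Then ‖f‖_∞ ≤ 1, f is 1-Lipschitz, ∫ f dμ_S = 1, and ∫ f dγ_k ≤ N ω_k / (2π)^{k/2}, where ω_k is the volume of the Euclidean unit ball in ℝ^k. Consequently the bounded-Lipschitz distance satisfies d_BL(μ_S, γ_k) ≥ 1 − N ω_k / (2π)^{k/2}. -/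
open MeasureTheory ProbabilityTheory Real
open scoped ENNReal NNReal RealInnerProductSpace

noncomputable section

/-- Domination of a product of probability measures by a product of `c • volume`. -/
theorem pi_le_aux (k : ℕ) (μ : Measure ℝ) [IsProbabilityMeasure μ] (c : ℝ≥0)
    (h : μ ≤ c • (volume : Measure ℝ)) :
    (Measure.pi fun _ : Fin k => μ) ≤ (c ^ k) • (volume : Measure (Fin k → ℝ)) := by
  have h2 : (Measure.pi fun _ : Fin k => c • (volume : Measure ℝ))
      = (c ^ k) • (volume : Measure (Fin k → ℝ)) := by
    apply Measure.pi_eq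
    intro s hs
    rw [Measure.smul_apply, volume_pi_pi]
    simp only [Measure.smul_apply, ENNReal.smul_def, smul_eq_mul, Finset.prod_mul_distrib]
    simp
  rw [← h2]
  have h3 : (Measure.pi fun _ : Fin k => μ).toOuterMeasure ≤
      OuterMeasure.pi fun _ : Fin k => (c • (volume : Measure ℝ)).toOuterMeasure := by
    rw [OuterMeasure.le_pi]
    intro s _
    have := Measure.pi_pi (fun _ : Fin k => μ) s
    refine this.le.trans ?_
    exact Finset.prod_le_prod' fun i _ => h (s i)
  refine Measure.le_iff.2 fun s hs => ?_
  have h4 := h3 s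
  rw [Measure.pi_def (fun _ : Fin k => c • (volume : Measure ℝ)), toMeasure_apply _ _ hs]
  exact h4

theorem gaussianReal_le_aux :
    gaussianReal 0 1 ≤ (Real.toNNReal (√(2 * π))⁻¹) • (volume : Measure ℝ) := by
  rw [gaussianReal_of_var_ne_zero 0 one_ne_zero]
  have : (Real.toNNReal (√(2 * π))⁻¹) • (volume : Measure ℝ) =
      volume.withDensity (fun _ => ((Real.toNNReal (√(2 * π))⁻¹ : ℝ≥0) : ℝ≥0∞)) := by
    rw [withDensity_const]; rfl
  rw [this]
  refine withDensity_mono (ae_of_all _ fun x => ?_)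
  rw [gaussianPDF_def, gaussianPDFReal_def]
  refine ENNReal.ofReal_le_ofReal ?_
  simp only [NNReal.coe_one, mul_one, sub_zero]
  refine mul_le_of_le_one_right (by positivity) ?_
  rw [Real.exp_le_one_iff]
  nlinarith [sq_nonneg x]

theorem stdGaussian_le_aux (k : ℕ) :
    stdGaussian k ≤ ((Real.toNNReal (√(2 * π))⁻¹) ^ k) •
      (volume : Measure (EuclideanSpace ℝ (Fin k))) := by
  have h := pi_le_aux k (gaussianReal 0 1) _ gaussianReal_le_aux
  have hm : Measurable (EuclideanSpace.equiv (Fin k) ℝ).symm :=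
    (EuclideanSpace.equiv (Fin k) ℝ).symm.continuous.measurable
  have hv : (volume : Measure (Fin k → ℝ)).map (EuclideanSpace.equiv (Fin k) ℝ).symm
      = (volume : Measure (EuclideanSpace ℝ (Fin k))) :=
    (PiLp.volume_preserving_toLp (Fin k)).map_eq
  have h2 := Measure.map_mono h hm
  rw [Measure.map_smul, hv] at h2
  exact h2

theorem const_aux (k : ℕ) :
    (((Real.toNNReal (√(2 * π))⁻¹) ^ k : ℝ≥0) : ℝ) = ((2 * π) ^ ((k : ℝ) / 2))⁻¹ := by
  have : (0 : ℝ) ≤ 2 * π := by positivity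
  rw [NNReal.coe_pow, Real.coe_toNNReal _ (by positivity), inv_pow, Real.sqrt_eq_rpow,
    ← Real.rpow_natCast, ← Real.rpow_mul this]
  congr 2
  ring

instance isProb_stdGaussian_aux (k : ℕ) :
    IsProbabilityMeasure (stdGaussian k : Measure (EuclideanSpace ℝ (Fin k))) := by
  unfold _root_.stdGaussian
  exact Measure.isProbabilityMeasure_map
    (EuclideanSpace.equiv (Fin k) ℝ).symm.continuous.measurable.aemeasurable

theorem ball_aux (k : ℕ) (x : EuclideanSpace ℝ (Fin k)) :
    (stdGaussian k : Measure (EuclideanSpace ℝ (Fin k))).real (Metric.ball x 1) ≤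
      (volume (Metric.ball (0 : EuclideanSpace ℝ (Fin k)) 1)).toReal /
        (2 * π) ^ ((k : ℝ) / 2) := by
  have h := stdGaussian_le_aux k (Metric.ball x 1)
  rw [Measure.smul_apply,
    Measure.addHaar_ball_center (volume : Measure (EuclideanSpace ℝ (Fin k))), ENNReal.smul_def, smul_eq_mul] at h
  have h2 := ENNReal.toReal_mono (ENNReal.mul_ne_top ENNReal.coe_ne_top
    (measure_ball_lt_top.ne)) h
  rw [ENNReal.toReal_mul, ENNReal.coe_toReal, const_aux] at h2
  rw [div_eq_inv_mul]
  exact h2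

theorem abs_integral_le_aux {k : ℕ} (μ : Measure (EuclideanSpace ℝ (Fin k)))
    [IsProbabilityMeasure μ] (f : EuclideanSpace ℝ (Fin k) → ℝ) (hf : ∀ x, |f x| ≤ 1) :
    |∫ x, f x ∂μ| ≤ 1 := by
  have := norm_integral_le_of_norm_le_const (μ := μ) (f := f) (C := 1)
    (ae_of_all _ fun x => by simpa using hf x)
  simpa using this

/-- **The sharpness test function.** For a nonempty finite set `S ⊂ ℝ^k` with `N` points,
the function `f(x) = (1 - dist(x,S))₊` has `‖f‖_∞ ≤ 1`, is `1`-Lipschitz, has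
`∫ f dμ_S = 1` for the uniform measure `μ_S` on `S`, and `∫ f dγ_k ≤ N ω_k/(2π)^{k/2}`;
consequently `d_BL(μ_S, γ_k) ≥ 1 - N ω_k/(2π)^{k/2}`. -/
theorem sharpness_test_function
    (k : ℕ) (hk : 0 < k)
    (S : Finset (EuclideanSpace ℝ (Fin k))) (hS : S.Nonempty) :
    let μS : Measure (EuclideanSpace ℝ (Fin k)) :=
      (S.card : ℝ≥0∞)⁻¹ • ∑ x ∈ S, Measure.dirac x
    let f : EuclideanSpace ℝ (Fin k) → ℝ :=
      fun x => max 0 (1 - Metric.infDist x (S : Set (EuclideanSpace ℝ (Fin k))))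
    let ωk : ℝ := (volume (Metric.ball (0 : EuclideanSpace ℝ (Fin k)) 1)).toReal
    (∀ x, |f x| ≤ 1) ∧ LipschitzWith 1 f ∧
    (∫ x, f x ∂μS) = 1 ∧
    (∫ x, f x ∂(stdGaussian k)) ≤ S.card * ωk / (2 * π) ^ ((k : ℝ) / 2) ∧
    1 - S.card * ωk / (2 * π) ^ ((k : ℝ) / 2) ≤ dBL μS (stdGaussian k) := by
  intro μS f ωk
  have hSne : (S : Set (EuclideanSpace ℝ (Fin k))).Nonempty := hS
  have hf0 : ∀ x, 0 ≤ f x := fun x => le_max_left _ _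
  have hf1 : ∀ x, f x ≤ 1 := fun x =>
    max_le zero_le_one (sub_le_self 1 Metric.infDist_nonneg)
  have hab : ∀ x, |f x| ≤ 1 := fun x => by rw [abs_of_nonneg (hf0 x)]; exact hf1 x
  have hL : LipschitzWith 1 f := by
    have h1 : LipschitzWith 1 fun x : EuclideanSpace ℝ (Fin k) =>
        1 - Metric.infDist x (S : Set (EuclideanSpace ℝ (Fin k))) := by
      refine LipschitzWith.of_dist_le_mul fun x y => ?_
      have := (Metric.lipschitz_infDist_pt (S : Set (EuclideanSpace ℝ (Fin k)))).dist_le_mul x y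
      rw [dist_sub_left]
      exact this
    exact h1.const_max 0
  have hcard : (S.card : ℝ≥0∞) ≠ 0 := by simpa using hS.ne_empty
  have hcardR : (S.card : ℝ) ≠ 0 := by simpa using hS.ne_empty
  have hμ : IsProbabilityMeasure μS := ⟨by
    simp only [μS, Measure.smul_apply, Measure.finsetSum_apply, measure_univ, smul_eq_mul,
      Finset.sum_const, nsmul_eq_mul, mul_one]
    exact ENNReal.inv_mul_cancel hcard (ENNReal.natCast_ne_top _)⟩
  have hint : (∫ x, f x ∂μS) = 1 := by
    have hfS : ∀ x ∈ S, f x = 1 := fun x hx => by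
      have : Metric.infDist x (S : Set (EuclideanSpace ℝ (Fin k))) = 0 :=
        Metric.infDist_zero_of_mem hx
      simp [f, this]
    rw [integral_smul_measure, integral_finsetSum_measure]
    · simp only [integral_dirac]
      rw [Finset.sum_congr rfl hfS]
      simp [hcardR]
    · intro i _
      exact integrable_dirac (by simp)
  have hg : (∫ x, f x ∂(stdGaussian k)) ≤ S.card * ωk / (2 * π) ^ ((k : ℝ) / 2) := by
    have hb : ∀ x, f x ≤ ∑ y ∈ S, (Metric.ball y 1).indicator (fun _ => (1 : ℝ)) x := by
      intro x
      have hnn : ∀ y ∈ S, 0 ≤ (Metric.ball y 1).indicator (fun _ => (1 : ℝ)) x :=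
        fun y _ => Set.indicator_nonneg (fun _ _ => zero_le_one) x
      by_cases hx : Metric.infDist x (S : Set (EuclideanSpace ℝ (Fin k))) < 1
      · obtain ⟨y, hy, hxy⟩ := (Metric.infDist_lt_iff hSne).1 hx
        refine (hf1 x).trans ?_
        refine le_trans ?_ (Finset.single_le_sum hnn hy)
        rw [Set.indicator_of_mem (Metric.mem_ball.2 hxy)]
      · have : f x = 0 := max_eq_left (by linarith)
        rw [this]
        exact Finset.sum_nonneg hnn
    have hi : ∀ y ∈ S, Integrable ((Metric.ball y 1).indicator (fun _ => (1 : ℝ)))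
        (stdGaussian k : Measure (EuclideanSpace ℝ (Fin k))) := fun y _ =>
      (integrable_const 1).indicator Metric.isOpen_ball.measurableSet
    calc (∫ x, f x ∂(stdGaussian k))
        ≤ ∫ x, ∑ y ∈ S, (Metric.ball y 1).indicator (fun _ => (1 : ℝ)) x ∂(stdGaussian k) :=
          integral_mono_of_nonneg (ae_of_all _ hf0) (integrable_finsetSum _ hi) (ae_of_all _ hb)
      _ = ∑ y ∈ S, (stdGaussian k : Measure (EuclideanSpace ℝ (Fin k))).real
            (Metric.ball y 1) := by
          rw [integral_finsetSum _ hi]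
          refine Finset.sum_congr rfl fun y _ => ?_
          exact integral_indicator_one Metric.isOpen_ball.measurableSet
      _ ≤ ∑ y ∈ S, ωk / (2 * π) ^ ((k : ℝ) / 2) := Finset.sum_le_sum fun y _ => ball_aux k y
      _ = S.card * ωk / (2 * π) ^ ((k : ℝ) / 2) := by
          rw [Finset.sum_const, nsmul_eq_mul, mul_div_assoc]
  refine ⟨hab, hL, hint, hg, ?_⟩
  have hbd : BddAbove (Set.range fun g : {g : EuclideanSpace ℝ (Fin k) → ℝ //
      (∀ x, |g x| ≤ 1) ∧ LipschitzWith 1 g} =>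
      |∫ x, g.1 x ∂μS - ∫ x, g.1 x ∂(stdGaussian k)|) := by
    refine ⟨2, ?_⟩
    rintro _ ⟨g, rfl⟩
    have h1 := abs_integral_le_aux μS g.1 g.2.1
    have h2 := abs_integral_le_aux (stdGaussian k) g.1 g.2.1
    exact (abs_sub _ _).trans (by linarith)
  refine le_trans ?_ (le_ciSup hbd ⟨f, hab, hL⟩)
  refine le_trans ?_ (le_abs_self _)
  simp only [hint]
  linarith

end
end
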